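/- arXiv:1210.4487 — 2 statements merged into one kernel-verified Lean document; each statement's English description precedes it below -/
import Mathlib

section
/- Let A be a nonnegative vector in ℝⁿ, D = A₁+⋯+Aₙ+n, and Ω ⊂ ℝⁿ a bounded domain. Then there exist constants c₁ > 0 and C₂, depending only on D, such that for every C¹ function u with compact support in Ω with ∫_Ω x^A|∇u|^D dx ≤ 1, one has ∫_Ω exp((c₁|u|)^{D/(D−1)}) x^A dx ≤ C₂ ∫_Ω x^A dx. -/
open MeasureTheory

namespace WTrud
open Set ENNReal

abbrev EE (n : ℕ) := EuclideanSpace ℝ (Fin n)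

noncomputable def ww {n : ℕ} (A : Fin n → ℝ) (x : EE n) : ℝ := ∏ i, |x i| ^ A i

lemma ww_nonneg {n : ℕ} (A : Fin n → ℝ) (x : EE n) : 0 ≤ ww A x :=
  Finset.prod_nonneg fun _ _ => Real.rpow_nonneg (abs_nonneg _) _

lemma ww_cont {n : ℕ} (A : Fin n → ℝ) (hA : ∀ i, 0 ≤ A i) : Continuous (ww A) := by
  unfold ww
  refine continuous_finsetProd _ fun i _ => ?_
  refine Continuous.rpow_const (by fun_prop) (fun x => Or.inr (hA i))

noncomputable def wE {n : ℕ} (A : Fin n → ℝ) (x : EE n) : ℝ≥0∞ := ENNReal.ofReal (ww A x)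

lemma wE_meas {n : ℕ} (A : Fin n → ℝ) (hA : ∀ i, 0 ≤ A i) : Measurable (wE A) :=
  (ww_cont A hA).measurable.ennreal_ofReal

lemma ray {n : ℕ} {v : EE n → ℝ} (hv : ContDiff ℝ 1 v) (hc : HasCompactSupport v)
    (x ω : EE n) (hω : ω ≠ 0) :
    ‖v x‖ₑ ≤ ∫⁻ t in Ioi (0:ℝ), ‖fderiv ℝ v (x + t • ω)‖ₑ * ‖ω‖ₑ := by
  have hemb : Topology.IsClosedEmbedding (fun t : ℝ => x - t • ω) := by
    have h1 : Topology.IsClosedEmbedding (fun t : ℝ => t • ω) := isClosedEmbedding_smul_left hω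
    have h2 : Topology.IsClosedEmbedding (fun z : EE n => x - z) :=
      (Homeomorph.subLeft x).isClosedEmbedding
    exact h2.comp h1
  have h := HasCompactSupport.enorm_le_lintegral_Ici_deriv (f := fun t : ℝ => v (x - t • ω))
    (hv.comp (by fun_prop)) (hc.comp_isClosedEmbedding hemb) 0
  simp only [zero_smul, sub_zero] at h
  refine h.trans ?_
  have e : ∫⁻ y in Iic (0:ℝ), ‖deriv (fun t : ℝ => v (x - t • ω)) y‖ₑ
      ≤ ∫⁻ y in Iic (0:ℝ), ‖fderiv ℝ v (x + (-y) • ω)‖ₑ * ‖ω‖ₑ := by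
    gcongr with y
    have hd : HasDerivAt (fun t : ℝ => v (x - t • ω)) (fderiv ℝ v (x - y • ω) (-ω)) y := by
      have h1 : HasFDerivAt v (fderiv ℝ v (x - y • ω)) (x - y • ω) :=
        (hv.differentiable one_ne_zero).differentiableAt.hasFDerivAt
      have h2 : HasDerivAt (fun t : ℝ => x - t • ω) (-ω) y := by
        simpa using ((hasDerivAt_id y).smul_const ω).const_sub x
      exact h1.comp_hasDerivAt y h2
    rw [hd.deriv, neg_smul, ← sub_eq_add_neg]
    calc _ ≤ ‖fderiv ℝ v (x - y • ω)‖ₑ * ‖-ω‖ₑ := ContinuousLinearMap.le_opENorm _ _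
      _ = _ := by rw [enorm_neg]
  refine e.trans (le_of_eq ?_)
  rw [← restrict_Iio_eq_restrict_Iic]
  have := (Measure.measurePreserving_neg (volume : Measure ℝ)).setLIntegral_comp_preimage_emb
    (MeasurableEquiv.neg ℝ).measurableEmbedding
    (fun t => ‖fderiv ℝ v (x + t • ω)‖ₑ * ‖ω‖ₑ) (Ioi 0)
  simpa using this

def BB (n : ℕ) : Set (EE n) := {ω | ∀ i, 1 ≤ |ω i| ∧ |ω i| ≤ 2}

lemma BB_meas (n : ℕ) : MeasurableSet (BB n) := by
  have : BB n = ⋂ i, {ω | 1 ≤ |ω i| ∧ |ω i| ≤ 2} := by ext; simp [BB]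
  rw [this]
  refine MeasurableSet.iInter fun i => ?_
  have h1 : MeasurableSet {ω : EE n | 1 ≤ |ω i|} := measurableSet_le (by fun_prop) (by fun_prop)
  have h2 : MeasurableSet {ω : EE n | |ω i| ≤ 2} := measurableSet_le (by fun_prop) (by fun_prop)
  exact h1.inter h2

lemma vol_box {n : ℕ} (a b : Fin n → ℝ) :
    volume {ω : EE n | ∀ i, a i ≤ ω i ∧ ω i ≤ b i} = ∏ i, ENNReal.ofReal (b i - a i) := by
  rw [← Real.volume_Icc_pi, ← (EuclideanSpace.volume_preserving_symm_measurableEquiv_toLp (Fin n)).measure_preimage_equiv]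
  congr 1
  ext ω
  simp [Pi.le_def, forall_and]

lemma BB_vol (n : ℕ) : volume (BB n) ≤ 4 ^ n := by
  calc volume (BB n) ≤ volume {ω : EE n | ∀ i, (fun _ => (-2:ℝ)) i ≤ ω i ∧ ω i ≤ (fun _ => (2:ℝ)) i} := by
        apply measure_mono
        intro ω hω i
        exact abs_le.1 (hω i).2
    _ = _ := by
        rw [vol_box]; simp; norm_num

lemma sec_vol {n : ℕ} (x : EE n) : 1 ≤ volume (BB n ∩ {ω | ∀ i, 0 ≤ ω i * x i}) := by
  have h := vol_box (n := n) (fun i => if 0 ≤ x i then 1 else -2) (fun i => if 0 ≤ x i then 2 else -1)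
  have h2 : ∏ i, ENNReal.ofReal ((if 0 ≤ x i then (2:ℝ) else -1) - (if 0 ≤ x i then 1 else -2)) = 1 := by
    apply Finset.prod_eq_one
    intro i _
    split_ifs <;> norm_num
  rw [h2] at h
  rw [← h]
  apply measure_mono
  intro ω hω
  constructor
  · intro i
    have := hω i
    simp only at this
    split_ifs at this
    · rw [abs_of_nonneg (by linarith)]; exact this
    · rw [abs_of_nonpos (by linarith)]; constructor <;> linarith
  · intro i
    have := hω i
    simp only at this
    split_ifs at this <;> nlinarith

noncomputable def HH {n : ℕ} (A : Fin n → ℝ) (F : Set (EE n)) (ω x : EE n) : ℝ≥0∞ :=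
  {p : EE n × EE n | p.2 ∈ F ∧ ∀ i, 0 ≤ p.1 i * p.2 i}.indicator (fun p => wE A p.2) (ω, x)

lemma HH_meas {n : ℕ} (A : Fin n → ℝ) (hA : ∀ i, 0 ≤ A i) {F : Set (EE n)} (hF : MeasurableSet F) :
    Measurable (fun p : EE n × EE n => HH A F p.1 p.2) := by
  unfold HH
  refine Measurable.indicator ((wE_meas A hA).comp measurable_snd) ?_
  refine MeasurableSet.inter (measurable_snd hF) ?_
  have : {p : EE n × EE n | ∀ i, 0 ≤ p.1 i * p.2 i} = ⋂ i, {p | 0 ≤ p.1 i * p.2 i} := by ext; simp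
  change MeasurableSet {p : EE n × EE n | ∀ i, 0 ≤ p.1 i * p.2 i}
  rw [this]
  exact MeasurableSet.iInter fun i => measurableSet_le (by fun_prop) (by fun_prop)

lemma coord {ω y t : ℝ} (ht : 0 < t) (h1 : 1 ≤ |ω|) (h : 0 ≤ ω * (y - t * ω)) :
    |y - t * ω| ≤ |y| ∧ t ≤ |y| := by
  rcases le_total 0 ω with h0 | h0
  · rw [abs_of_nonneg h0] at h1
    have : 0 ≤ y - t * ω := by by_contra hh; nlinarith
    have h3 : t ≤ t * ω := by nlinarith
    rw [abs_of_nonneg this, abs_of_nonneg (by linarith)]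
    constructor <;> linarith
  · rw [abs_of_nonpos h0] at h1
    have : y - t * ω ≤ 0 := by by_contra hh; nlinarith
    have h3 : t ≤ - (t * ω) := by nlinarith
    rw [abs_of_nonpos this, abs_of_nonpos (by linarith)]
    constructor <;> linarith

lemma HH_le1 {n : ℕ} (A : Fin n → ℝ) (hA : ∀ i, 0 ≤ A i) (F : Set (EE n)) {ω y : EE n} {t : ℝ}
    (ht : 0 < t) (hω : ω ∈ BB n) : HH A F ω (y - t • ω) ≤ wE A y := by
  unfold HH
  by_cases h : (ω, y - t • ω) ∈ {p : EE n × EE n | p.2 ∈ F ∧ ∀ i, 0 ≤ p.1 i * p.2 i}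
  · rw [indicator_of_mem h]
    apply ENNReal.ofReal_le_ofReal
    apply Finset.prod_le_prod
    · intro i _; positivity
    · intro i _
      have := coord ht (hω i).1 (by simpa using h.2 i)
      apply Real.rpow_le_rpow (abs_nonneg _) _ (hA i)
      simpa using this.1
  · rw [indicator_of_notMem h]; exact zero_le

lemma HH_le2 {n : ℕ} {D : ℝ} (A : Fin n → ℝ) (hA : ∀ i, 0 ≤ A i) (hD : (∑ i, A i) + n = D)
    (F : Set (EE n)) {ω y : EE n} {t : ℝ}
    (ht : 0 < t) (hω : ω ∈ BB n) : HH A F ω (y - t • ω) ≤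
      (ENNReal.ofReal (t ^ (n - D)) * wE A y) * F.indicator (wE A) (y - t • ω) := by
  unfold HH
  by_cases h : (ω, y - t • ω) ∈ {p : EE n × EE n | p.2 ∈ F ∧ ∀ i, 0 ≤ p.1 i * p.2 i}
  · rw [indicator_of_mem h, indicator_of_mem h.1]
    refine le_mul_of_one_le_left zero_le ?_
    unfold wE
    rw [← ENNReal.ofReal_mul (by positivity), ENNReal.one_le_ofReal]
    have : t ^ (D - n) ≤ ww A y := by
      have e : D - n = ∑ i, A i := by linarith
      rw [e, Real.rpow_sum_of_pos ht]
      apply Finset.prod_le_prod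
      · intro i _; positivity
      · intro i _
        exact Real.rpow_le_rpow ht.le (coord ht (hω i).1 (by simpa using h.2 i)).2 (hA i)
    calc (1:ℝ) = t ^ (n - D) * t ^ (D - n) := by rw [← Real.rpow_add ht]; simp
      _ ≤ _ := by gcongr
  · rw [indicator_of_notMem h]; exact zero_le

lemma scale {n : ℕ} {g : EE n → ℝ≥0∞} (hg : Measurable g) (y : EE n) {t : ℝ} (ht : 0 < t) :
    ∫⁻ ω, g (y - t • ω) = ENNReal.ofReal (t ^ (-(n:ℝ))) * ∫⁻ x, g x := by
  have h1 : ∫⁻ ω, g (y - t • ω) = ∫⁻ z, g (y - z) ∂(Measure.map (t • ·) (volume : Measure (EE n))) := by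
    rw [lintegral_map (by fun_prop) (by fun_prop)]
  rw [h1, Measure.map_addHaar_smul _ ht.ne', lintegral_smul_measure, lintegral_sub_left_eq_self]
  simp [abs_of_pos ht, Real.rpow_neg ht.le]

lemma bracket {n : ℕ} {D : ℝ} (hD1 : 1 < D) (A : Fin n → ℝ) (hA : ∀ i, 0 ≤ A i)
    (hD : (∑ i, A i) + n = D)
    {F : Set (EE n)} (hF : MeasurableSet F) (y : EE n) {ρ : ℝ} (hρ : 0 < ρ) :
    ∫⁻ t in Ioi (0:ℝ), ∫⁻ ω in BB n, HH A F ω (y - t • ω) ≤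
      wE A y * (4 ^ n * ENNReal.ofReal ρ + ENNReal.ofReal (ρ ^ (1 - D) / (D - 1)) * ∫⁻ x in F, wE A x) := by
  have hJ1 : ∀ t ∈ Ioc 0 ρ, ∫⁻ ω in BB n, HH A F ω (y - t • ω) ≤ wE A y * 4 ^ n := by
    intro t ht
    calc _ ≤ ∫⁻ ω in BB n, wE A y := setLIntegral_mono' (BB_meas n) fun ω hω => HH_le1 A hA F ht.1 hω
      _ ≤ _ := by rw [setLIntegral_const]; gcongr; exact BB_vol n
  have hJ2 : ∀ t ∈ Ioi ρ, ∫⁻ ω in BB n, HH A F ω (y - t • ω) ≤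
      ENNReal.ofReal (t ^ (-D)) * (wE A y * ∫⁻ x in F, wE A x) := by
    intro t ht
    have ht0 : 0 < t := hρ.trans ht
    calc _ ≤ ∫⁻ ω in BB n, (ENNReal.ofReal (t ^ (n - D)) * wE A y) * F.indicator (wE A) (y - t • ω) :=
          setLIntegral_mono' (BB_meas n) fun ω hω => HH_le2 A hA hD F ht0 hω
      _ ≤ ∫⁻ ω, (ENNReal.ofReal (t ^ (n - D)) * wE A y) * F.indicator (wE A) (y - t • ω) :=
          setLIntegral_le_lintegral _ _
      _ = (ENNReal.ofReal (t ^ (n - D)) * wE A y) * (ENNReal.ofReal (t ^ (-(n:ℝ))) * ∫⁻ x in F, wE A x) := by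
          have hm : Measurable (F.indicator (wE A)) := (wE_meas A hA).indicator hF
          rw [lintegral_const_mul _ (by fun_prop), scale hm y ht0, lintegral_indicator hF]
      _ = (ENNReal.ofReal (t ^ (n - D)) * ENNReal.ofReal (t ^ (-(n:ℝ)))) * (wE A y * ∫⁻ x in F, wE A x) := by ring
      _ = _ := by
          rw [← ENNReal.ofReal_mul (by positivity), ← Real.rpow_add ht0]
          congr 3; ring
  have hsplit : Ioi (0:ℝ) = Ioc 0 ρ ∪ Ioi ρ := (Ioc_union_Ioi_eq_Ioi hρ.le).symm
  rw [hsplit]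
  refine (lintegral_union_le _ _ _).trans ?_
  have e1 : ∫⁻ t in Ioc (0:ℝ) ρ, ∫⁻ ω in BB n, HH A F ω (y - t • ω) ≤ wE A y * 4 ^ n * ENNReal.ofReal ρ := by
    refine (setLIntegral_mono' measurableSet_Ioc hJ1).trans ?_
    rw [setLIntegral_const]; simp
  have e2 : ∫⁻ t in Ioi ρ, ∫⁻ ω in BB n, HH A F ω (y - t • ω) ≤
      ENNReal.ofReal (ρ ^ (1 - D) / (D - 1)) * (wE A y * ∫⁻ x in F, wE A x) := by
    refine (setLIntegral_mono' measurableSet_Ioi hJ2).trans ?_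
    rw [lintegral_mul_const _ (by fun_prop)]
    gcongr
    rw [← ofReal_integral_eq_lintegral_ofReal (integrableOn_Ioi_rpow_of_lt (by linarith) hρ)
      ((ae_restrict_iff' measurableSet_Ioi).2 (Filter.Eventually.of_forall fun t ht =>
        Real.rpow_nonneg (hρ.le.trans (le_of_lt ht)) _)), integral_Ioi_rpow_of_lt (by linarith) hρ]
    apply le_of_eq
    congr 1
    rw [show -D + 1 = -(D - 1) by ring, show (1 - D) = -(D-1) by ring, div_neg, neg_div, neg_neg]
  calc _ ≤ _ := add_le_add e1 e2
    _ = _ := by ring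


lemma BB_norm {n : ℕ} {ω : EE n} (hω : ω ∈ BB n) : ‖ω‖ ≤ 2 * n := by
  rw [EuclideanSpace.norm_eq]
  apply Real.sqrt_le_iff.2
  refine ⟨by positivity, ?_⟩
  have h1 : ∑ i, ‖ω i‖ ^ 2 ≤ ∑ i : Fin n, (4:ℝ) := by
    apply Finset.sum_le_sum
    intro i _
    have := (hω i).2
    rw [Real.norm_eq_abs]
    nlinarith [abs_nonneg (ω i)]
  simp at h1
  have : (n:ℝ) ≤ n * n := by exact_mod_cast Nat.le_mul_self n
  simp only [Real.norm_eq_abs, sq_abs]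
  nlinarith

lemma BB_ne {n : ℕ} (hn : 0 < n) {ω : EE n} (hω : ω ∈ BB n) : ω ≠ 0 := by
  rintro rfl
  have := (hω ⟨0, hn⟩).1
  norm_num at this

lemma sob_pre {n : ℕ} (hn : 0 < n) {D : ℝ} (hD1 : 1 < D) (A : Fin n → ℝ) (hA : ∀ i, 0 ≤ A i)
    (hD : (∑ i, A i) + n = D) {F : Set (EE n)} (hF : MeasurableSet F)
    {v : EE n → ℝ} (hv : ContDiff ℝ 1 v) (hc : HasCompactSupport v) {ρ : ℝ} (hρ : 0 < ρ) :
    ∫⁻ x in F, ‖v x‖ₑ * wE A x ≤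
      ENNReal.ofReal (2 * n) * ((4 ^ n * ENNReal.ofReal ρ +
        ENNReal.ofReal (ρ ^ (1 - D) / (D - 1)) * ∫⁻ x in F, wE A x) *
        ∫⁻ y, ‖fderiv ℝ v y‖ₑ * wE A y) := by
  set G : EE n → ℝ≥0∞ := fun y => ‖fderiv ℝ v y‖ₑ with hG
  have hGm : Measurable G := (hv.continuous_fderiv one_ne_zero).enorm.measurable
  set P : Measure (EE n × ℝ) := (volume.restrict (BB n)).prod (volume.restrict (Ioi 0)) with hP
  set c := ENNReal.ofReal (2 * n)
  have hHm := HH_meas A hA hF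
  have m1 : Measurable (fun q : EE n × (EE n × ℝ) => HH A F q.2.1 q.1 * G (q.1 + q.2.2 • q.2.1)) :=
    (hHm.comp (f := fun q : EE n × (EE n × ℝ) => (q.2.1, q.1)) (by fun_prop)).mul
      (hGm.comp (by fun_prop))
  have m2 : Measurable (fun q : EE n × (EE n × ℝ) => HH A F q.2.1 (q.1 - q.2.2 • q.2.1) * G q.1) :=
    (hHm.comp (f := fun q : EE n × (EE n × ℝ) => (q.2.1, q.1 - q.2.2 • q.2.1)) (by fun_prop)).mul
      (hGm.comp (by fun_prop))
  have step1 : ∀ x ∈ F, ‖v x‖ₑ * wE A x ≤ c * ∫⁻ p, HH A F p.1 x * G (x + p.2 • p.1) ∂P := by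
    intro x hx
    have mx : Measurable (fun p : EE n × ℝ => HH A F p.1 x * G (x + p.2 • p.1)) :=
      m1.comp (f := fun p : EE n × ℝ => (x, p)) (by fun_prop)
    rw [hP, lintegral_prod _ mx.aemeasurable]
    have mS : MeasurableSet (BB n ∩ {ω | ∀ i, 0 ≤ ω i * x i}) := by
      refine (BB_meas n).inter ?_
      have : {ω : EE n | ∀ i, 0 ≤ ω i * x i} = ⋂ i, {ω | 0 ≤ ω i * x i} := by ext; simp
      rw [this]
      exact MeasurableSet.iInter fun i => measurableSet_le (by fun_prop) (by fun_prop)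
    calc ‖v x‖ₑ * wE A x ≤ (‖v x‖ₑ * wE A x) * volume (BB n ∩ {ω | ∀ i, 0 ≤ ω i * x i}) :=
          le_mul_of_one_le_right zero_le (sec_vol x)
      _ = ∫⁻ ω in BB n ∩ {ω | ∀ i, 0 ≤ ω i * x i}, ‖v x‖ₑ * wE A x := by rw [setLIntegral_const]
      _ ≤ ∫⁻ ω in BB n ∩ {ω | ∀ i, 0 ≤ ω i * x i}, c * ∫⁻ t in Ioi (0:ℝ), HH A F ω x * G (x + t • ω) := by
          refine setLIntegral_mono' mS fun ω hω => ?_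
          have hH : HH A F ω x = wE A x := by
            unfold HH
            rw [indicator_of_mem]
            exact ⟨hx, hω.2⟩
          have mt : Measurable (fun t : ℝ => G (x + t • ω)) := hGm.comp (by fun_prop)
          rw [hH, lintegral_const_mul _ mt, mul_comm, mul_left_comm]
          gcongr
          refine (ray hv hc x ω (BB_ne hn hω.1)).trans ?_
          rw [lintegral_mul_const _ mt, mul_comm]
          gcongr
          rw [← ofReal_norm]
          exact ENNReal.ofReal_le_ofReal (BB_norm hω.1)
      _ ≤ ∫⁻ ω in BB n, c * ∫⁻ t in Ioi (0:ℝ), HH A F ω x * G (x + t • ω) :=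
          lintegral_mono_set inter_subset_left
      _ = _ := by
          rw [lintegral_const_mul]
          exact mx.lintegral_prod_right'
  calc ∫⁻ x in F, ‖v x‖ₑ * wE A x
      ≤ ∫⁻ x in F, c * ∫⁻ p, HH A F p.1 x * G (x + p.2 • p.1) ∂P := setLIntegral_mono' hF step1
    _ ≤ ∫⁻ x, c * ∫⁻ p, HH A F p.1 x * G (x + p.2 • p.1) ∂P := setLIntegral_le_lintegral _ _
    _ = c * ∫⁻ x, ∫⁻ p, HH A F p.1 x * G (x + p.2 • p.1) ∂P :=
        lintegral_const_mul _ m1.lintegral_prod_right'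
    _ = c * ∫⁻ p, (∫⁻ x, HH A F p.1 x * G (x + p.2 • p.1)) ∂P := by
        rw [lintegral_lintegral_swap m1.aemeasurable]
    _ = c * ∫⁻ p, (∫⁻ y, HH A F p.1 (y - p.2 • p.1) * G y) ∂P := by
        congr 2
        ext p
        rw [← lintegral_sub_right_eq_self _ (p.2 • p.1)]
        simp
    _ = c * ∫⁻ y, (∫⁻ p, HH A F p.1 (y - p.2 • p.1) * G y ∂P) := by
        rw [lintegral_lintegral_swap
          (f := fun (y : EE n) (p : EE n × ℝ) => HH A F p.1 (y - p.2 • p.1) * G y) m2.aemeasurable]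
    _ ≤ c * ∫⁻ y, (4 ^ n * ENNReal.ofReal ρ +
        ENNReal.ofReal (ρ ^ (1 - D) / (D - 1)) * ∫⁻ x in F, wE A x) * (G y * wE A y) := by
        gcongr with y
        have my : Measurable (fun p : EE n × ℝ => HH A F p.1 (y - p.2 • p.1)) :=
          hHm.comp (f := fun p : EE n × ℝ => (p.1, y - p.2 • p.1)) (by fun_prop)
        rw [lintegral_mul_const _ my, hP, lintegral_prod_symm _ my.aemeasurable]
        calc _ ≤ _ := mul_le_mul_left (bracket hD1 A hA hD hF y hρ) (G y)
          _ = _ := by ring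
    _ = _ := by
        rw [lintegral_const_mul]
        exact hGm.mul (wE_meas A hA)

/-- weak Sobolev, real form -/
lemma weak_sob {n : ℕ} (hn : 0 < n) {D : ℝ} (hD1 : 1 < D) (A : Fin n → ℝ) (hA : ∀ i, 0 ≤ A i)
    (hD : (∑ i, A i) + n = D) {F : Set (EE n)} (hF : MeasurableSet F)
    {v : EE n → ℝ} (hv : ContDiff ℝ 1 v) (hc : HasCompactSupport v)
    (hfin : ∫⁻ x in F, wE A x ≠ ∞) (h1 : ∀ x ∈ F, 1 ≤ v x) :
    (∫⁻ x in F, wE A x) ^ (1 - 1 / D) ≤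
      ENNReal.ofReal (2 * D * (4 ^ D + 1 / (D - 1))) * ∫⁻ y, ‖fderiv ℝ v y‖ₑ * wE A y := by
  have hD0 : 0 < D := by linarith
  have hexp : 0 < 1 - 1 / D := by rw [sub_pos, div_lt_one hD0]; exact hD1
  set m := ∫⁻ x in F, wE A x with hm
  set I := ∫⁻ y, ‖fderiv ℝ v y‖ₑ * wE A y
  by_cases hm0 : m = 0
  · rw [hm0, ENNReal.zero_rpow_of_pos hexp]; exact zero_le
  have hmr : 0 < m.toReal := ENNReal.toReal_pos hm0 hfin
  set ρ := m.toReal ^ (1 / D) with hρdef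
  have hρ : 0 < ρ := Real.rpow_pos_of_pos hmr _
  have h2 := sob_pre hn hD1 A hA hD hF hv hc hρ
  rw [← hm] at h2
  have hlow : m ≤ ∫⁻ x in F, ‖v x‖ₑ * wE A x := by
    refine setLIntegral_mono' hF fun x hx => ?_
    refine le_mul_of_one_le_left zero_le ?_
    rw [← ofReal_norm, ENNReal.one_le_ofReal]
    exact (h1 x hx).trans (le_abs_self _)
  have hmρ : ENNReal.ofReal ρ = m ^ (1 / D) := by
    rw [hρdef, ← ENNReal.ofReal_rpow_of_pos hmr, ENNReal.ofReal_toReal hfin]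
  have hnD : (n:ℝ) ≤ D := by
    have := Finset.sum_nonneg fun i (_ : i ∈ Finset.univ) => hA i
    linarith
  have hbr : 4 ^ n * ENNReal.ofReal ρ + ENNReal.ofReal (ρ ^ (1 - D) / (D - 1)) * m ≤
      ENNReal.ofReal (4 ^ D + 1 / (D - 1)) * m ^ (1 / D) := by
    have e1 : (4:ℝ≥0∞) ^ n ≤ ENNReal.ofReal (4 ^ D) := by
      have : (4:ℝ≥0∞) ^ n = ENNReal.ofReal (4 ^ n) := by
        rw [ENNReal.ofReal_pow (by norm_num)]; norm_num
      rw [this]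
      apply ENNReal.ofReal_le_ofReal
      rw [← Real.rpow_natCast]
      exact Real.rpow_le_rpow_of_exponent_le (by norm_num) hnD
    have e2 : ENNReal.ofReal (ρ ^ (1 - D) / (D - 1)) * m = ENNReal.ofReal (1 / (D - 1)) * ENNReal.ofReal ρ := by
      have e3 : ENNReal.ofReal (ρ ^ (1 - D) / (D - 1)) * m =
          ENNReal.ofReal (ρ ^ (1 - D) / (D - 1)) * ENNReal.ofReal m.toReal := by
        rw [ENNReal.ofReal_toReal hfin]
      rw [e3]
      have hD1' : 0 < D - 1 := by linarith
      rw [← ENNReal.ofReal_mul (by positivity), ← ENNReal.ofReal_mul (by positivity)]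
      congr 1
      have : m.toReal = ρ ^ D := by
        rw [hρdef, ← Real.rpow_mul hmr.le]
        field_simp
        simp
      rw [this, Real.rpow_sub hρ, Real.rpow_one]
      have : 0 < ρ ^ D := by positivity
      field_simp
    rw [e2, ← hmρ, ENNReal.ofReal_add (by positivity) (by have : 0 < D - 1 := by linarith
                                                          positivity), add_mul]
    gcongr
  have key : m ≤ m ^ (1 / D) * (ENNReal.ofReal (2 * D * (4 ^ D + 1 / (D - 1))) * I) := by
    calc m ≤ _ := hlow.trans h2
      _ ≤ ENNReal.ofReal (2 * D) * ((ENNReal.ofReal (4 ^ D + 1 / (D - 1)) * m ^ (1 / D)) * I) := by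
          gcongr
      _ = _ := by rw [ENNReal.ofReal_mul (p := 2 * D) (by positivity)]; ring
  rw [ENNReal.rpow_sub _ _ hm0 hfin, ENNReal.rpow_one]
  apply ENNReal.div_le_of_le_mul
  rwa [mul_comm]


lemma trans_bound : ∃ L : ℝ, 0 < L ∧ (∀ t, |deriv Real.smoothTransition t| ≤ L) ∧
    ∀ t, t ∉ Ioo (0:ℝ) 1 → deriv Real.smoothTransition t = 0 := by
  have hz : ∀ t, t ∉ Ioo (0:ℝ) 1 → deriv Real.smoothTransition t = 0 := by
    intro t ht
    rcases le_or_gt t 0 with h | h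
    · apply IsLocalMin.deriv_eq_zero
      refine Filter.Eventually.of_forall fun y => ?_
      rw [Real.smoothTransition.zero_of_nonpos h]
      exact Real.smoothTransition.nonneg y
    · apply IsLocalMax.deriv_eq_zero
      refine Filter.Eventually.of_forall fun y => ?_
      have : 1 ≤ t := by by_contra hh; exact ht ⟨h, not_le.1 hh⟩
      rw [Real.smoothTransition.one_of_one_le this]
      exact Real.smoothTransition.le_one y
  have hcont : Continuous (deriv Real.smoothTransition) :=
    (Real.smoothTransition.contDiff (n := 1)).continuous_deriv le_rfl
  obtain ⟨C, hC⟩ := (isCompact_Icc (a := (0:ℝ)) (b := 1)).exists_bound_of_continuousOn hcont.continuousOn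
  refine ⟨max C 1, by positivity, fun t => ?_, hz⟩
  by_cases ht : t ∈ Ioo (0:ℝ) 1
  · exact (hC t (Ioo_subset_Icc_self ht)).trans (le_max_left _ _)
  · rw [hz t ht]; simp

noncomputable def mu {n : ℕ} (A : Fin n → ℝ) : Measure (EE n) := volume.withDensity (wE A)

noncomputable def nu {n : ℕ} (A : Fin n → ℝ) (D : ℝ) (u : EE n → ℝ) : Measure (EE n) :=
  (mu A).withDensity (fun x => ‖fderiv ℝ u x‖ₑ ^ D)

def FF {n : ℕ} (u : EE n → ℝ) (t : ℝ) : Set (EE n) := {x | u x ≠ 0 ∧ t ≤ u x}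

lemma FF_meas {n : ℕ} {u : EE n → ℝ} (hu : Continuous u) (t : ℝ) : MeasurableSet (FF u t) :=
  MeasurableSet.inter (isOpen_ne_fun hu continuous_const).measurableSet
    (isClosed_le continuous_const hu).measurableSet

noncomputable def KK (D : ℝ) : ℝ := 2 * D * (4 ^ D + 1 / (D - 1))

lemma slab {n : ℕ} (hn : 0 < n) {D : ℝ} (hD1 : 1 < D) (A : Fin n → ℝ) (hA : ∀ i, 0 ≤ A i)
    (hD : (∑ i, A i) + n = D) {L : ℝ} (hL0 : 0 < L)
    (hL : ∀ t, |deriv Real.smoothTransition t| ≤ L)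
    (hL' : ∀ t, t ∉ Ioo (0:ℝ) 1 → deriv Real.smoothTransition t = 0)
    {u : EE n → ℝ} (hu : ContDiff ℝ 1 u) (hc : HasCompactSupport u)
    (hfin : mu A {x | u x ≠ 0} ≠ ∞)
    {a h : ℝ} (ha : 0 ≤ a) (hh : 0 < h) :
    mu A (FF u (a + h)) ^ (1 - 1 / D) ≤ ENNReal.ofReal (KK D * L / h) *
      (nu A D u (FF u a \ FF u (a + h)) ^ (1 / D) *
        mu A (FF u a \ FF u (a + h)) ^ (1 - 1 / D)) := by
  have hD0 : 0 < D := by linarith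
  have hK : 0 ≤ KK D := by
    unfold KK; have : 0 < D - 1 := by linarith
    positivity
  set v : EE n → ℝ := fun x => Real.smoothTransition ((u x - a) / h) with hv
  have hvC : ContDiff ℝ 1 v := by
    have := (Real.smoothTransition.contDiff (n := 1))
    exact this.comp (by fun_prop)
  have hvc : HasCompactSupport v := by
    refine hc.comp_left (g := fun t => Real.smoothTransition ((t - a) / h)) ?_
    apply Real.smoothTransition.zero_of_nonpos
    apply div_nonpos_of_nonpos_of_nonneg <;> linarith
  have hGm : Measurable (fun x => ‖fderiv ℝ u x‖ₑ) := (hu.continuous_fderiv one_ne_zero).enorm.measurable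
  set S := FF u a \ FF u (a + h) with hS
  have hSm : MeasurableSet S := (FF_meas hu.continuous _).diff (FF_meas hu.continuous _)
  have hder : ∀ x, ‖fderiv ℝ v x‖ₑ ≤ ENNReal.ofReal (L / h) * S.indicator (fun x => ‖fderiv ℝ u x‖ₑ) x := by
    intro x
    have h1 : HasFDerivAt u (fderiv ℝ u x) x := (hu.differentiable one_ne_zero).differentiableAt.hasFDerivAt
    have h2 : HasFDerivAt (fun x => (u x - a) / h) (h⁻¹ • fderiv ℝ u x) x := by
      simpa [div_eq_mul_inv] using (h1.sub_const a).mul_const h⁻¹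
    have h3 : HasDerivAt Real.smoothTransition (deriv Real.smoothTransition ((u x - a) / h)) ((u x - a) / h) :=
      ((Real.smoothTransition.contDiff (n := 1)).differentiable one_ne_zero).differentiableAt.hasDerivAt
    have h4 := (h3.comp_hasFDerivAt x h2).fderiv
    change fderiv ℝ v x = _ at h4
    rw [h4]
    by_cases hx : (u x - a) / h ∈ Ioo (0:ℝ) 1
    · have hxS : x ∈ S := by
        have h5 : a < u x := by
          have := hx.1; rw [lt_div_iff₀ hh] at this; linarith
        have h6 : u x < a + h := by
          have := hx.2; rw [div_lt_iff₀ hh] at this; linarith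
        exact ⟨⟨by linarith, h5.le⟩, fun h7 => absurd h7.2 (not_le.2 h6)⟩
      rw [indicator_of_mem hxS, ← ofReal_norm, ← ofReal_norm, ← ENNReal.ofReal_mul (by positivity)]
      apply ENNReal.ofReal_le_ofReal
      rw [norm_smul, norm_smul, norm_inv, Real.norm_of_nonneg hh.le, ← mul_assoc, div_eq_mul_inv L, Real.norm_eq_abs]
      gcongr
      exact hL _
    · rw [hL' _ hx, zero_smul, ← ofReal_norm, norm_zero, ENNReal.ofReal_zero]; exact zero_le
  have hmu : ∀ s : Set (EE n), MeasurableSet s → mu A s = ∫⁻ x in s, wE A x :=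
    fun s hs => withDensity_apply _ hs
  have hF := FF_meas hu.continuous (a + h)
  have hfinF : mu A (FF u (a + h)) ≠ ∞ :=
    ne_top_of_le_ne_top hfin (measure_mono fun x hx => hx.1)
  have hw := weak_sob hn hD1 A hA hD hF hvC hvc (by rwa [← hmu _ hF]) (by
    intro x hx
    rw [hv]
    simp only
    rw [Real.smoothTransition.one_of_one_le]
    rw [one_le_div hh]; linarith [hx.2])
  rw [← hmu _ hF] at hw
  have hI : ∫⁻ y, ‖fderiv ℝ v y‖ₑ * wE A y ≤ ENNReal.ofReal (L / h) *
      ∫⁻ y in S, ‖fderiv ℝ u y‖ₑ ∂(mu A) := by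
    have : ∫⁻ y in S, ‖fderiv ℝ u y‖ₑ ∂(mu A) = ∫⁻ y, wE A y * S.indicator (fun x => ‖fderiv ℝ u x‖ₑ) y := by
      rw [← lintegral_indicator hSm, mu, lintegral_withDensity_eq_lintegral_mul _ (wE_meas A hA) (hGm.indicator hSm)]
      rfl
    have hm3 : Measurable (fun y => wE A y * S.indicator (fun x => ‖fderiv ℝ u x‖ₑ) y) :=
      (wE_meas A hA).mul (hGm.indicator hSm)
    rw [this, ← lintegral_const_mul _ hm3]
    refine lintegral_mono fun y => ?_
    calc _ ≤ (ENNReal.ofReal (L / h) * S.indicator (fun x => ‖fderiv ℝ u x‖ₑ) y) * wE A y := by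
          gcongr; exact hder y
      _ = _ := by ring
  have hpq : D.HolderConjugate (D / (D - 1)) := Real.HolderConjugate.conjExponent hD1
  have hH := ENNReal.lintegral_mul_le_Lp_mul_Lq ((mu A).restrict S) hpq
    (f := fun x => ‖fderiv ℝ u x‖ₑ) (g := fun _ => 1) hGm.aemeasurable aemeasurable_const
  have hq : 1 / (D / (D - 1)) = 1 - 1 / D := by
    have : D - 1 ≠ 0 := by linarith
    field_simp
  have hnu : nu A D u S = ∫⁻ x in S, ‖fderiv ℝ u x‖ₑ ^ D ∂(mu A) := withDensity_apply _ hSm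
  rw [hq] at hH
  simp only [Pi.mul_apply, mul_one, ENNReal.one_rpow, lintegral_const, one_mul,
    Measure.restrict_apply_univ] at hH
  rw [← hnu] at hH
  calc _ ≤ _ := hw
    _ ≤ ENNReal.ofReal (KK D) * (ENNReal.ofReal (L / h) * (nu A D u S ^ (1 / D) * mu A S ^ (1 - 1 / D))) := by
        unfold KK
        gcongr
        exact hI.trans (by gcongr)
    _ = _ := by
        rw [← mul_assoc, ← ENNReal.ofReal_mul hK, mul_div_assoc]

lemma halving (m e : ℕ → ℝ) (N : ℕ) (hm : ∀ k, m (k+1) ≤ m k) (he : ∀ k, e (k+1) ≤ e k)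
    (hm0 : ∀ k, 0 ≤ m k) (hN : 0 < N)
    (h : ∀ k, e k - e (k+1) ≤ 2 / N → 2 * m (k+1) ≤ m k) :
    ∀ k, m k ≤ m 0 * (2:ℝ) ^ (-(k - N / 2 * (e 0 - e k)) : ℝ) := by
  intro k
  have hN' : (0:ℝ) < N := by exact_mod_cast hN
  induction k with
  | zero => simp
  | succ k ih =>
    have hk : m (k+1) ≤ m k * (2:ℝ) ^ (-(1 - N / 2 * (e k - e (k+1))) : ℝ) := by
      by_cases hc : e k - e (k+1) ≤ 2 / N
      · have h1 := h k hc
        have h2 : (2:ℝ)⁻¹ ≤ (2:ℝ) ^ (-(1 - N / 2 * (e k - e (k+1))) : ℝ) := by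
          rw [← Real.rpow_neg_one]
          apply Real.rpow_le_rpow_of_exponent_le (by norm_num)
          have : 0 ≤ N / 2 * (e k - e (k+1)) := mul_nonneg (by positivity) (by linarith [he k])
          linarith
        calc m (k+1) ≤ m k * 2⁻¹ := by linarith
          _ ≤ _ := by gcongr; exact hm0 k
      · have h2 : (1:ℝ) ≤ (2:ℝ) ^ (-(1 - N / 2 * (e k - e (k+1))) : ℝ) := by
          apply Real.one_le_rpow (by norm_num)
          push Not at hc
          rw [div_lt_iff₀ hN'] at hc
          linarith
        exact (hm k).trans (le_mul_of_one_le_right (hm0 k) h2)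
    calc m (k+1) ≤ _ := hk
      _ ≤ (m 0 * (2:ℝ) ^ (-(k - N / 2 * (e 0 - e k)) : ℝ)) * (2:ℝ) ^ (-(1 - N / 2 * (e k - e (k+1))) : ℝ) := by gcongr
      _ = _ := by
        rw [mul_assoc, ← Real.rpow_add (by norm_num)]
        congr 2
        push_cast
        ring

lemma level {n : ℕ} (hn : 0 < n) {D : ℝ} (hD1 : 1 < D) (A : Fin n → ℝ) (hA : ∀ i, 0 ≤ A i)
    (hD : (∑ i, A i) + n = D) {L : ℝ} (hL0 : 0 < L)
    (hL : ∀ t, |deriv Real.smoothTransition t| ≤ L)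
    (hL' : ∀ t, t ∉ Ioo (0:ℝ) 1 → deriv Real.smoothTransition t = 0)
    {u : EE n → ℝ} (hu : ContDiff ℝ 1 u) (hc : HasCompactSupport u)
    (hfin : mu A {x | u x ≠ 0} ≠ ∞) (hen : nu A D u {x | u x ≠ 0} ≤ 1) (N : ℕ) :
    mu A (FF u (2 * KK D * L * (N:ℝ) ^ (1 - 1 / D))) ≤
      ENNReal.ofReal ((2:ℝ) ^ (-(N / 2 : ℝ))) * mu A {x | u x ≠ 0} := by
  rcases Nat.eq_zero_or_pos N with rfl | hN
  · simp; exact measure_mono fun x hx => hx.1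
  have hN' : (0:ℝ) < N := by exact_mod_cast hN
  have hD0 : 0 < D := by linarith
  have hK : 0 < KK D := by
    unfold KK; have : 0 < D - 1 := by linarith
    positivity
  have hθ : 0 < 1 - 1 / D := by rw [sub_pos, div_lt_one hD0]; exact hD1
  set h : ℝ := 2 * KK D * L * (N:ℝ) ^ (-(1 / D)) with hh
  have hh0 : 0 < h := by positivity
  have hNh : 2 * KK D * L * (N:ℝ) ^ (1 - 1 / D) = N * h := by
    rw [hh, sub_eq_add_neg, Real.rpow_add hN', Real.rpow_one]; ring
  rw [hNh]
  have fm : ∀ t, mu A (FF u t) ≠ ∞ := fun t => ne_top_of_le_ne_top hfin (measure_mono fun x hx => hx.1)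
  have fe : ∀ t, nu A D u (FF u t) ≠ ∞ := fun t =>
    ne_top_of_le_ne_top one_ne_top ((measure_mono fun x hx => hx.1).trans hen)
  have mono : ∀ k : ℕ, FF u ((k+1 : ℕ) * h) ⊆ FF u (k * h) := by
    intro k x hx
    refine ⟨hx.1, le_trans ?_ hx.2⟩
    push_cast; nlinarith
  set m : ℕ → ℝ := fun k => (mu A (FF u (k * h))).toReal with hm
  set e : ℕ → ℝ := fun k => (nu A D u (FF u (k * h))).toReal with he
  have hm1 : ∀ k, m (k+1) ≤ m k := fun k => ENNReal.toReal_mono (fm _) (measure_mono (mono k))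
  have he1 : ∀ k, e (k+1) ≤ e k := fun k => ENNReal.toReal_mono (fe _) (measure_mono (mono k))
  have key := halving m e N hm1 he1 (fun k => ENNReal.toReal_nonneg) hN (by
    intro k hk
    have hs := slab hn hD1 A hA hD hL0 hL hL' hu hc hfin (a := k * h) (h := h) (by positivity) hh0
    have hkh : (k:ℝ) * h + h = ((k+1 : ℕ) : ℝ) * h := by push_cast; ring
    rw [hkh] at hs
    rw [measure_sdiff (mono k) (FF_meas hu.continuous _).nullMeasurableSet (fm _),
      measure_sdiff (mono k) (FF_meas hu.continuous _).nullMeasurableSet (fe _)] at hs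
    have hs2 := ENNReal.toReal_mono (by
      refine ENNReal.mul_ne_top ENNReal.ofReal_ne_top (ENNReal.mul_ne_top ?_ ?_)
      · exact ENNReal.rpow_ne_top_of_nonneg (by positivity) (ENNReal.sub_ne_top (fe _))
      · exact ENNReal.rpow_ne_top_of_nonneg hθ.le (ENNReal.sub_ne_top (fm _))) hs
    rw [ENNReal.toReal_mul, ENNReal.toReal_mul, ENNReal.toReal_ofReal (by positivity),
      ← ENNReal.toReal_rpow, ← ENNReal.toReal_rpow, ← ENNReal.toReal_rpow,
      ENNReal.toReal_sub_of_le (measure_mono (mono k)) (fe _),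
      ENNReal.toReal_sub_of_le (measure_mono (mono k)) (fm _)] at hs2
    change m (k+1) ^ (1 - 1 / D) ≤ KK D * L / h * ((e k - e (k+1)) ^ (1 / D) * (m k - m (k+1)) ^ (1 - 1 / D)) at hs2
    have c1 : KK D * L / h * (e k - e (k+1)) ^ (1 / D) ≤ 1 := by
      have e1 : KK D * L / h = (N:ℝ) ^ (1 / D) / 2 := by
        rw [hh, Real.rpow_neg hN'.le]
        field_simp
      rw [e1]
      calc (N:ℝ) ^ (1 / D) / 2 * (e k - e (k+1)) ^ (1 / D) ≤ (N:ℝ) ^ (1 / D) / 2 * (2 / N) ^ (1 / D) := by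
            gcongr
            linarith [he1 k]
        _ = 2 ^ (1 / D) / 2 := by
            rw [Real.div_rpow (by norm_num) hN'.le]
            field_simp
        _ ≤ 2 ^ (1:ℝ) / 2 := by
            gcongr
            · norm_num
            · rw [div_le_one hD0]; exact hD1.le
        _ = 1 := by norm_num
    have c2 : m (k+1) ^ (1 - 1 / D) ≤ (m k - m (k+1)) ^ (1 - 1 / D) := by
      refine hs2.trans ?_
      rw [← mul_assoc]
      exact mul_le_of_le_one_left (Real.rpow_nonneg (by linarith [hm1 k]) _) c1
    have c3 := (Real.rpow_le_rpow_iff ENNReal.toReal_nonneg (by linarith [hm1 k]) hθ).1 c2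
    linarith) N
  have e0 : e 0 ≤ 1 := by
    have : nu A D u (FF u ((0:ℕ) * h)) ≤ 1 := (measure_mono fun x hx => hx.1).trans hen
    simpa [he] using ENNReal.toReal_mono one_ne_top this
  have eN : 0 ≤ e N := ENNReal.toReal_nonneg
  have m0 : m 0 ≤ (mu A {x | u x ≠ 0}).toReal := ENNReal.toReal_mono hfin (measure_mono fun x hx => hx.1)
  have fin : m N ≤ (2:ℝ) ^ (-(N / 2 : ℝ)) * (mu A {x | u x ≠ 0}).toReal := by
    refine key.trans ?_
    rw [mul_comm]
    gcongr
    · norm_num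
    · nlinarith
  rw [← ENNReal.ofReal_toReal (fm _), ← ENNReal.ofReal_toReal hfin, ← ENNReal.ofReal_mul (by positivity)]
  exact ENNReal.ofReal_le_ofReal fin


lemma cont_int {n : ℕ} {f : EE n → ℝ} (hf : Continuous f) {Ω : Set (EE n)}
    (hΩ : Bornology.IsBounded Ω) : IntegrableOn f Ω :=
  (hf.locallyIntegrable.integrableOn_isCompact hΩ.isCompact_closure).mono_set subset_closure

lemma final {n : ℕ} (hn : 0 < n) {D : ℝ} (hD1 : 1 < D) (A : Fin n → ℝ) (hA : ∀ i, 0 ≤ A i)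
    (hD : (∑ i, A i) + n = D) {L : ℝ} (hL0 : 0 < L)
    (hL : ∀ t, |deriv Real.smoothTransition t| ≤ L)
    (hL' : ∀ t, t ∉ Ioo (0:ℝ) 1 → deriv Real.smoothTransition t = 0)
    {Ω : Set (EE n)} (hΩ : Bornology.IsBounded Ω)
    {u : EE n → ℝ} (hu : ContDiff ℝ 1 u) (hc : HasCompactSupport u)
    (hs : tsupport u ⊆ Ω) (hI : (∫ x in Ω, ww A x * ‖gradient u x‖ ^ D) ≤ 1) :
    ∫⁻ x in Ω, ENNReal.ofReal (Real.exp (((Real.log 2 / 4) ^ (1 - 1 / D) / (2 * KK D * L) * |u x|) ^ (D / (D - 1)))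
      * ww A x) ≤
    (∑' N : ℕ, ENNReal.ofReal ((2:ℝ) ^ ((N + 1) / 4 : ℝ)) * (2 * ENNReal.ofReal ((2:ℝ) ^ (-(N / 2 : ℝ))))) *
      ∫⁻ x in Ω, wE A x := by
  have hD0 : 0 < D := by linarith
  have hDm : 0 < D - 1 := by linarith
  have hK : 0 < KK D := by unfold KK; positivity
  set B := 2 * KK D * L with hB
  have hB0 : 0 < B := by positivity
  have hθ : 0 < 1 - 1 / D := by rw [sub_pos, div_lt_one hD0]; exact hD1
  have hθs : (1 - 1 / D) * (D / (D - 1)) = 1 := by field_simp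
  have hs0 : 0 < D / (D - 1) := by positivity
  have hlog : 0 < Real.log 2 := Real.log_pos (by norm_num)
  set M := ∫⁻ x in Ω, wE A x with hM
  have hMfin : M ≠ ∞ := ((cont_int (ww_cont A hA) hΩ).lintegral_lt_top).ne
  have hsub : {x | u x ≠ 0} ⊆ Ω := (subset_tsupport u).trans hs
  have hMle : mu A {x | u x ≠ 0} ≤ M := by
    refine (measure_mono hsub).trans (le_of_eq ?_)
    rw [mu, withDensity_apply']
  have hfin := ne_top_of_le_ne_top hMfin hMle
  have hne : MeasurableSet {x | u x ≠ 0} := (isOpen_ne_fun hu.continuous continuous_const).measurableSet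
  have hgrad : ∀ x, ‖gradient u x‖ = ‖fderiv ℝ u x‖ := fun x => by
    unfold gradient; exact LinearIsometryEquiv.norm_map _ _
  have hGm : Measurable (fun x => ‖fderiv ℝ u x‖ₑ ^ D) :=
    (hu.continuous_fderiv one_ne_zero).enorm.measurable.pow_const D
  have hen : nu A D u {x | u x ≠ 0} ≤ 1 := by
    simp only [hgrad] at hI
    have hint : IntegrableOn (fun x => ww A x * ‖fderiv ℝ u x‖ ^ D) Ω := by
      refine cont_int ((ww_cont A hA).mul ?_) hΩ
      exact (hu.continuous_fderiv one_ne_zero).norm.rpow_const fun x => Or.inr hD0.le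
    rw [nu, withDensity_apply _ hne, mu, setLIntegral_withDensity_eq_setLIntegral_mul _ (wE_meas A hA) hGm hne]
    calc _ ≤ ∫⁻ x in Ω, ENNReal.ofReal (ww A x * ‖fderiv ℝ u x‖ ^ D) := by
          refine (lintegral_mono_set hsub).trans (le_of_eq ?_)
          refine lintegral_congr fun x => ?_
          rw [Pi.mul_apply, ENNReal.ofReal_mul (ww_nonneg A x), ← ofReal_norm,
            ENNReal.ofReal_rpow_of_nonneg (norm_nonneg _) hD0.le]
          rfl
      _ = ENNReal.ofReal (∫ x in Ω, ww A x * ‖fderiv ℝ u x‖ ^ D) :=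
          (ofReal_integral_eq_lintegral_ofReal hint (Filter.Eventually.of_forall fun x =>
            mul_nonneg (ww_nonneg A x) (by positivity))).symm
      _ ≤ 1 := by rw [ENNReal.ofReal_le_one]; exact hI
  set v : EE n → ℝ := fun x => - u x with hv
  have hve : {x | v x ≠ 0} = {x | u x ≠ 0} := by ext; simp [hv]
  have hnv : nu A D v = nu A D u := by
    unfold nu
    congr 1
    ext x
    rw [hv, fderiv_fun_neg, enorm_neg]
  have lu := level hn hD1 A hA hD hL0 hL hL' hu hc hfin hen
  have lv := level hn hD1 A hA hD hL0 hL hL' (u := v) hu.neg hc.neg (by rwa [hve]) (by rwa [hve, hnv])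
  rw [hve] at lv
  rw [← hB] at lu lv
  set G : ℕ → Set (EE n) := fun N => {x | B * (N:ℝ) ^ (1 - 1 / D) ≤ |u x|} with hG
  have hGmeas : ∀ N, MeasurableSet (G N) := fun N =>
    (isClosed_le continuous_const hu.continuous.abs).measurableSet
  have hGb : ∀ N, ∫⁻ x in Ω, (G N).indicator (wE A) x ≤ 2 * ENNReal.ofReal ((2:ℝ) ^ (-(N / 2 : ℝ))) * M := by
    intro N
    rcases Nat.eq_zero_or_pos N with rfl | hN
    · simp only [Nat.cast_zero, zero_div, neg_zero, Real.rpow_zero, ENNReal.ofReal_one, mul_one]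
      calc _ ≤ M := lintegral_mono fun x => indicator_le_self _ _ _
        _ ≤ _ := le_mul_of_one_le_left zero_le one_le_two
    · have hN' : (0:ℝ) < N := by exact_mod_cast hN
      have hpos : 0 < B * (N:ℝ) ^ (1 - 1 / D) := by positivity
      calc _ ≤ ∫⁻ x, (G N).indicator (wE A) x := setLIntegral_le_lintegral _ _
        _ = mu A (G N) := by rw [lintegral_indicator (hGmeas N), mu, withDensity_apply _ (hGmeas N)]
        _ ≤ mu A (FF u (B * (N:ℝ) ^ (1 - 1 / D)) ∪ FF v (B * (N:ℝ) ^ (1 - 1 / D))) := by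
            apply measure_mono
            intro x hx
            rcases le_abs.1 (show B * (N:ℝ) ^ (1 - 1 / D) ≤ |u x| from hx) with h | h
            · exact Or.inl ⟨by linarith, h⟩
            · exact Or.inr ⟨by simp only [hv]; linarith, h⟩
        _ ≤ _ := measure_union_le _ _
        _ ≤ _ := add_le_add (lu N) (lv N)
        _ = 2 * ENNReal.ofReal ((2:ℝ) ^ (-(N / 2 : ℝ))) * mu A {x | u x ≠ 0} := by ring
        _ ≤ _ := by gcongr
  have hpt : ∀ x, ENNReal.ofReal (Real.exp (((Real.log 2 / 4) ^ (1 - 1 / D) / B * |u x|) ^ (D / (D - 1)))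
      * ww A x) ≤ ∑' N : ℕ, ENNReal.ofReal ((2:ℝ) ^ ((N + 1) / 4 : ℝ)) * (G N).indicator (wE A) x := by
    intro x
    set X := (|u x| / B) ^ (D / (D - 1)) with hX
    have hX0 : 0 ≤ X := by positivity
    have e1 : ((Real.log 2 / 4) ^ (1 - 1 / D) / B * |u x|) ^ (D / (D - 1)) = Real.log 2 * (X / 4) := by
      rw [show (Real.log 2 / 4) ^ (1 - 1 / D) / B * |u x| = (Real.log 2 / 4) ^ (1 - 1 / D) * (|u x| / B) by ring,
        Real.mul_rpow (by positivity) (by positivity), ← Real.rpow_mul (by positivity), hθs, Real.rpow_one, ← hX]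
      ring
    rw [e1, ← Real.rpow_def_of_pos (by norm_num)]
    set N := ⌊X⌋₊ with hN
    have hNX : (N:ℝ) ≤ X := Nat.floor_le hX0
    have hXN : X ≤ N + 1 := (Nat.lt_floor_add_one X).le
    have hxG : x ∈ G N := by
      have h1 : (N:ℝ) ^ (1 - 1 / D) ≤ X ^ (1 - 1 / D) := by gcongr
      have h2 : X ^ (1 - 1 / D) = |u x| / B := by
        rw [hX, ← Real.rpow_mul (by positivity), mul_comm, hθs, Real.rpow_one]
      rw [h2, le_div_iff₀ hB0] at h1
      change B * (N:ℝ) ^ (1 - 1 / D) ≤ |u x|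
      linarith
    refine le_trans ?_ (ENNReal.le_tsum N)
    rw [indicator_of_mem hxG, ENNReal.ofReal_mul (by positivity)]
    unfold wE
    gcongr
    norm_num
  calc _ ≤ ∫⁻ x in Ω, ∑' N : ℕ, ENNReal.ofReal ((2:ℝ) ^ ((N + 1) / 4 : ℝ)) * (G N).indicator (wE A) x :=
        lintegral_mono hpt
    _ = ∑' N : ℕ, ENNReal.ofReal ((2:ℝ) ^ ((N + 1) / 4 : ℝ)) * ∫⁻ x in Ω, (G N).indicator (wE A) x := by
        rw [lintegral_tsum fun N => (((wE_meas A hA).indicator (hGmeas N)).const_mul _).aemeasurable]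
        congr 1
        ext N
        rw [lintegral_const_mul _ ((wE_meas A hA).indicator (hGmeas N))]
    _ ≤ ∑' N : ℕ, ENNReal.ofReal ((2:ℝ) ^ ((N + 1) / 4 : ℝ)) * (2 * ENNReal.ofReal ((2:ℝ) ^ (-(N / 2 : ℝ))) * M) :=
        ENNReal.tsum_le_tsum fun N => by gcongr; exact hGb N
    _ = _ := by
        rw [← ENNReal.tsum_mul_right]
        congr 1; ext N; ring

lemma sum_fin : (∑' N : ℕ, ENNReal.ofReal ((2:ℝ) ^ ((N + 1) / 4 : ℝ)) *
    (2 * ENNReal.ofReal ((2:ℝ) ^ (-(N / 2 : ℝ))))) ≠ ∞ := by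
  have hq : (2:ℝ) ^ (-(1/4) : ℝ) < 1 := Real.rpow_lt_one_of_one_lt_of_neg (by norm_num) (by norm_num)
  have h := ((summable_geometric_of_lt_one (by positivity) hq).mul_left (2 * (2:ℝ) ^ (1/4 : ℝ))).tsum_ofReal_ne_top
  convert h using 3 with N
  have : (2:ℝ≥0∞) = ENNReal.ofReal 2 := by norm_num
  rw [this, ← ENNReal.ofReal_mul (by positivity), ← ENNReal.ofReal_mul (by positivity)]
  congr 1
  rw [← Real.rpow_natCast, ← Real.rpow_mul (by norm_num), mul_left_comm, mul_assoc,
    ← Real.rpow_add (by norm_num), ← Real.rpow_add (by norm_num)]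
  congr 2
  ring

end WTrud

/-- Weighted Trudinger inequality, with constants depending only on `D`. -/
theorem weighted_trudinger_inequality (D : ℝ) :
    ∃ c₁ C₂ : ℝ, 0 < c₁ ∧
      ∀ (n : ℕ) (A : Fin n → ℝ), (∀ i, 0 ≤ A i) → (∑ i, A i) + n = D →
      ∀ Ω : Set (EuclideanSpace ℝ (Fin n)), Bornology.IsBounded Ω →
      ∀ u : EuclideanSpace ℝ (Fin n) → ℝ, ContDiff ℝ 1 u → HasCompactSupport u →
        tsupport u ⊆ Ω →
        (∫ x in Ω, (∏ i, |x i| ^ A i) * ‖gradient u x‖ ^ D) ≤ 1 →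
        (∫ x in Ω, Real.exp ((c₁ * |u x|) ^ (D / (D - 1))) * ∏ i, |x i| ^ A i)
          ≤ C₂ * ∫ x in Ω, ∏ i, |x i| ^ A i := by
  by_cases hD1 : 1 < D
  · obtain ⟨L, hL0, hL, hL'⟩ := WTrud.trans_bound
    have hK : 0 < WTrud.KK D := by
      unfold WTrud.KK
      have : 0 < D - 1 := by linarith
      positivity
    have hlog : 0 < Real.log 2 := Real.log_pos (by norm_num)
    refine ⟨(Real.log 2 / 4) ^ (1 - 1 / D) / (2 * WTrud.KK D * L),
      (∑' N : ℕ, ENNReal.ofReal ((2:ℝ) ^ ((N + 1) / 4 : ℝ)) *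
        (2 * ENNReal.ofReal ((2:ℝ) ^ (-(N / 2 : ℝ))))).toReal, by positivity, ?_⟩
    · intro n A hA hD Ω hΩ u hu hc hs hI
      have hn : 0 < n := by
        rcases Nat.eq_zero_or_pos n with rfl | h
        · simp at hD; linarith
        · exact h
      have hfin := WTrud.final hn hD1 A hA hD hL0 hL hL' hΩ hu hc hs hI
      have hs0 : 0 < D / (D - 1) := div_pos (by linarith) (by linarith)
      have hwi := WTrud.cont_int (WTrud.ww_cont A hA) hΩ
      have e1 : ∫ x in Ω, ∏ i, |x i| ^ A i = (∫⁻ x in Ω, WTrud.wE A x).toReal :=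
        integral_eq_lintegral_of_nonneg_ae
          (Filter.Eventually.of_forall fun x => WTrud.ww_nonneg A x) hwi.aestronglyMeasurable
      have hcont : Continuous fun x => Real.exp (((Real.log 2 / 4) ^ (1 - 1 / D) /
          (2 * WTrud.KK D * L) * |u x|) ^ (D / (D - 1))) * WTrud.ww A x := by
        refine Continuous.mul (Real.continuous_exp.comp ?_) (WTrud.ww_cont A hA)
        exact (continuous_const.mul hu.continuous.abs).rpow_const fun x => Or.inr hs0.le
      have e2 := integral_eq_lintegral_of_nonneg_ae (μ := volume.restrict Ω)
          (Filter.Eventually.of_forall fun x => mul_nonneg (Real.exp_nonneg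
            (((Real.log 2 / 4) ^ (1 - 1 / D) / (2 * WTrud.KK D * L) * |u x|) ^ (D / (D - 1))))
            (WTrud.ww_nonneg A x)) hcont.aestronglyMeasurable
      rw [e1]
      refine le_trans (le_of_eq e2) ?_
      rw [← ENNReal.toReal_mul]
      exact ENNReal.toReal_mono (ENNReal.mul_ne_top WTrud.sum_fin hwi.lintegral_lt_top.ne) hfin
  · refine ⟨1, Real.exp 1, one_pos, ?_⟩
    intro n A hA hD Ω hΩ u hu hc hs hI
    have hnn := Finset.sum_nonneg fun i (_ : i ∈ Finset.univ) => hA i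
    have hz : D / (D - 1) = 0 := by
      rcases Nat.eq_zero_or_pos n with rfl | h
      · simp at hD; simp [← hD]
      · have : (1:ℝ) ≤ n := by exact_mod_cast h
        have : D = 1 := by linarith
        simp [this]
    rw [hz]
    simp only [Real.rpow_zero]
    rw [integral_const_mul]
end

section
/- Let D > 1, 1 < p < D, q = Dp/(D−p), and let u : (0,∞) → ℝ be Lipschitz with ∫₀^∞ r^{D−1}|u'(r)|^p dr < ∞ and u(r) → 0 as r → ∞. Then (∫₀^∞ r^{D−1}|u(r)|^q dr)^{1/q} ≤ D^{-1/p} ((p−1)/(D−p))^{1/p'} ((1/p') B(D/p, D/p'))^{-1/D} (∫₀^∞ r^{D−1}|u'(r)|^p dr)^{1/p}, where p' = p/(p−1) and B is the Beta function. -/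
open MeasureTheory Real

/-- The Beta function defined via the Gamma function. -/
noncomputable def realBeta (p q : ℝ) : ℝ := Real.Gamma p * Real.Gamma q / Real.Gamma (p + q)


lemma tal_pw (D q p' m : ℝ) (hD : 1 < D) (hq : 0 < q) (hm : 0 < m) (hmq : m + q / D = q)
    (r T w a : ℝ) (hr : 0 < r) (hT : 0 < T) (hw : 0 ≤ w) (ha : 0 ≤ a)
    (hTa : a * (T^(D-1)*(1+T^p')^(-D)) = r^(D-1)*w^q) :
    D*(a*(T^(D-1)*(1+T^p')^(1-D))) ≤ w^m*(r^(D-1)*a + (D-1)*r^(D-2)*T) := by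
  have hD0 : 0 < D := by linarith
  have hy : 0 < 1 + T^p' := by positivity
  have hrD : 0 < r^(D-1) := by positivity
  have hX : a * (T/r)^(D-1) = w^q * (1+T^p')^D := by
    rw [Real.div_rpow hT.le hr.le]
    have h1 : (1+T^p')^(-D) = ((1+T^p')^D)⁻¹ := Real.rpow_neg hy.le D
    rw [h1] at hTa
    have : 0 < (1+T^p')^D := by positivity
    field_simp at hTa ⊢
    linarith
  have hX1 : a^(1/D) * (T/r)^((D-1)/D) = w^(q/D) * (1+T^p') := by
    have := congrArg (fun x => x^(1/D)) hX
    rw [Real.mul_rpow ha (by positivity), Real.mul_rpow (by positivity) (by positivity),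
      ← Real.rpow_mul (by positivity), ← Real.rpow_mul hw, ← Real.rpow_mul hy.le] at this
    rw [show (D-1)/D = (D-1)*(1/D) by ring, this]
    rw [mul_one_div_cancel hD0.ne', Real.rpow_one]
    congr 2; ring
  have hAM := Real.geom_mean_le_arith_mean2_weighted (w₁ := 1/D) (w₂ := (D-1)/D) (p₁ := a)
    (p₂ := T/r) (by positivity) (div_nonneg (by linarith) hD0.le) ha (by positivity)
    (by field_simp; ring)
  rw [hX1] at hAM
  have h2 : D * (w^(q/D) * (1+T^p')) ≤ a + (D-1) * (T/r) := by
    have := mul_le_mul_of_nonneg_left hAM hD0.le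
    calc _ ≤ _ := this
      _ = _ := by field_simp
  have h3 := mul_le_mul_of_nonneg_left h2 (show 0 ≤ w^m * r^(D-1) by positivity)
  have h4 : w^m * w^(q/D) = w^q := by
    rw [← Real.rpow_add_of_nonneg hw hm.le (by positivity), hmq]
  have h5 : (1+T^p')^(1-D) = (1+T^p') * (1+T^p')^(-D) := by
    rw [sub_eq_add_neg, Real.rpow_add hy, Real.rpow_one]
  have h6 : r^(D-2) = r^(D-1) / r := by
    rw [show D - 2 = (D-1) - 1 by ring, Real.rpow_sub_one hr.ne']
  calc _ = D * (1+T^p') * (a * (T^(D-1)*(1+T^p')^(-D))) := by rw [h5]; ring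
    _ = D * (1+T^p') * (r^(D-1)*(w^m * w^(q/D))) := by rw [hTa, h4]
    _ = w^m * r^(D-1) * (D * (w^(q/D) * (1+T^p'))) := by ring
    _ ≤ _ := h3
    _ = _ := by rw [h6]; field_simp

lemma tal_young (D p q p' m κ : ℝ) (hp : 1 < p) (hpp : p' = p / (p-1))
    (hκ : 0 < κ) (hm1 : 1 < m) (hmp : (m-1) * p' = q) (hmk : m * κ = (D-1) * p')
    (r T w v : ℝ) (hr : 0 < r) (hT : 0 < T) (hw : 0 ≤ w) (hv : 0 ≤ v) :
    m * w^(m-1)*v*r^(D-1)*T ≤ m/p*κ^(1-p)*(r^(D-1)*v^p) + (D-1)*(r^(D-1)*w^q)*T^p' := by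
  have hp' : 1 < p' := by rw [hpp, lt_div_iff₀] <;> linarith
  have hc : p.HolderConjugate p' := by
    rw [hpp]; exact Real.HolderConjugate.conjExponent hp
  have hpe := hc.inv_add_inv_eq_one
  have hY := Real.young_inequality_of_nonneg (a := κ^(-1/p') * v) (b := κ^(1/p') * (w^(m-1) * T))
    (by positivity) (by positivity) hc
  have e1 : κ^(-1/p') * v * (κ^(1/p') * (w^(m-1) * T)) = w^(m-1)*v*T := by
    have : κ^(-1/p') * κ^(1/p') = 1 := by
      rw [← Real.rpow_add hκ]; ring_nf; simp
    linear_combination (w^(m-1)*v*T) * this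
  have e2 : (κ^(-1/p') * v)^p = κ^(1-p) * v^p := by
    rw [Real.mul_rpow (by positivity) hv, ← Real.rpow_mul hκ.le]
    congr 2
    rw [hpp]; have : p - 1 ≠ 0 := by linarith
    have : p ≠ 0 := by linarith
    field_simp; ring
  have e3 : (κ^(1/p') * (w^(m-1) * T))^p' = κ * (w^q * T^p') := by
    rw [Real.mul_rpow (by positivity) (by positivity), ← Real.rpow_mul hκ.le,
      Real.mul_rpow (by positivity) (by positivity), ← Real.rpow_mul hw, hmp,
      one_div_mul_cancel (by linarith), Real.rpow_one]
  rw [e1, e2, e3] at hY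
  have h3 := mul_le_mul_of_nonneg_left hY (show 0 ≤ m * r^(D-1) by positivity)
  calc _ = m * r^(D-1) * (w^(m-1)*v*T) := by ring
    _ ≤ _ := h3
    _ = m/p*κ^(1-p)*(r^(D-1)*v^p) + (m * κ)/p'*(r^(D-1)*w^q)*T^p' := by field_simp
    _ = _ := by rw [hmk]; field_simp

lemma tal_ac {f f' : ℝ → ℝ} {a b : ℝ} (hab : a ≤ b)
    (hf : ∀ x ∈ Set.Icc a b, HasDerivAt f (f' x) x) (hc : ContinuousOn f' (Set.Icc a b)) :
    AbsolutelyContinuousOnInterval f a b := by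
  obtain ⟨C, hC⟩ := isCompact_Icc.exists_bound_of_continuousOn hc
  have : LipschitzOnWith (Real.toNNReal C) f (Set.Icc a b) := by
    apply Convex.lipschitzOnWith_of_nnnorm_hasDerivWithin_le (convex_Icc a b)
      (fun x hx => (hf x hx).hasDerivWithinAt)
    intro x hx
    rw [← NNReal.coe_le_coe, coe_nnnorm]
    exact (hC x hx).trans (Real.le_coe_toNNReal C)
  apply LipschitzOnWith.absolutelyContinuousOnInterval (K := Real.toNNReal C)
  rwa [Set.uIcc_of_le hab]

lemma tal_ac_rpow {w : ℝ → ℝ} {K : NNReal} (hw : LipschitzWith K w) (m : ℝ) (hm : 1 ≤ m) (a b : ℝ) :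
    AbsolutelyContinuousOnInterval (fun r => w r ^ m) a b := by
  have hcomp : IsCompact (w '' Set.uIcc a b) := isCompact_uIcc.image hw.continuous
  obtain ⟨B, hB⟩ := hcomp.isBounded.subset_closedBall 0
  have hcd : ContDiff ℝ 1 (fun x : ℝ => x ^ m) := by
    have := Real.contDiff_rpow_const_of_le (p := m) (n := 1) (by simpa using hm)
    simpa using this
  obtain ⟨L, hL⟩ := hcd.contDiffOn.exists_lipschitzOnWith (s := Metric.closedBall (0:ℝ) B) (by simp)
    (convex_closedBall _ _) (isCompact_closedBall _ _)
  have := hL.comp (hw.lipschitzOnWith (s := Set.uIcc a b)) (fun x hx => hB ⟨x, hx, rfl⟩)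
  exact this.absolutelyContinuousOnInterval

/-- inverse function derivative -/
lemma tal_inv {G F T : ℝ → ℝ} {g0 f0 r : ℝ} (hG : HasStrictDerivAt G g0 (T r)) (hg : g0 ≠ 0)
    (hT : ContinuousAt T r) (hF : HasDerivAt F f0 r) (hGT : ∀ᶠ y in nhds r, G (T y) = F y) :
    HasDerivAt T (f0 / g0) r := by
  have h1 := hT.eventually (hG.eventually_left_inverse hg)
  have h2 := (hG.to_localInverse hg).hasDerivAt
  rw [hGT.self_of_nhds] at h2
  have h3 := h2.comp r hF
  have : T =ᶠ[nhds r] (HasStrictDerivAt.localInverse G g0 (T r) hG hg) ∘ F := by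
    filter_upwards [h1, hGT] with y h1 h2
    simp [← h2, h1]
  have := h3.congr_of_eventuallyEq this
  rwa [div_eq_inv_mul]


/-- target density -/
noncomputable def talg (D p' s : ℝ) : ℝ := (max s 0)^(D-1) * (1+(max s 0)^p')^(-D)

lemma talg_cont (D p' : ℝ) (hD : 1 < D) (hp : 0 < p') : Continuous (talg D p') := by
  unfold talg
  refine Continuous.mul ?_ ?_
  · exact (continuous_id.max continuous_const).rpow_const (fun _ => Or.inr (by linarith))
  · refine Continuous.rpow_const ?_ (fun x => Or.inl ?_)
    · exact continuous_const.add
        ((continuous_id.max continuous_const).rpow_const (fun _ => Or.inr hp.le))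
    · have : 0 ≤ (max x 0)^p' := by positivity
      positivity

lemma talg_pos (D p' s : ℝ) (hs : 0 < s) : 0 < talg D p' s := by
  unfold talg
  rw [max_eq_left hs.le]; positivity

lemma talg_eq (D p' s : ℝ) (hs : 0 ≤ s) : talg D p' s = s^(D-1) * (1+s^p')^(-D) := by
  unfold talg
  rw [max_eq_left hs]

lemma tal_transport (g F : ℝ → ℝ) (hg : Continuous g) (hgp : ∀ s, 0 < s → 0 < g s)
    (N A : ℝ) (hN : 0 ≤ N) (hA : ∫ s in (0:ℝ)..N, g s = A) (hF : Continuous F)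
    (hF0 : ∀ r, 0 ≤ F r) (hFA : ∀ r, F r ≤ A) :
    ∃ T : ℝ → ℝ, Continuous T ∧ (∀ r, T r ∈ Set.Icc 0 N) ∧
      ∀ r, ∫ s in (0:ℝ)..(T r), g s = F r := by
  set G : ℝ → ℝ := fun t => ∫ s in (0:ℝ)..t, g s with hG
  have hGd : ∀ t, HasDerivAt G (g t) t := fun t =>
    intervalIntegral.integral_hasDerivAt_right (hg.intervalIntegrable _ _)
      hg.stronglyMeasurable.stronglyMeasurableAtFilter hg.continuousAt
  have hGc : Continuous G := continuous_iff_continuousAt.2 fun t => (hGd t).continuousAt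
  have hmono : StrictMonoOn G (Set.Ici 0) := by
    apply strictMonoOn_of_deriv_pos (convex_Ici 0) hGc.continuousOn
    intro x hx
    rw [interior_Ici] at hx
    rw [(hGd x).deriv]; exact hgp x hx
  have hsurj : ∀ r, ∃ t : Set.Icc (0:ℝ) N, G t = F r := by
    intro r
    have := intermediate_value_Icc hN hGc.continuousOn (show F r ∈ Set.Icc (G 0) (G N) from
      ⟨by simpa [hG] using hF0 r, by simpa [hG, hA] using hFA r⟩)
    obtain ⟨t, ht, h⟩ := this
    exact ⟨⟨t, ht⟩, h⟩
  choose T hT using hsurj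
  have hemb : Topology.IsClosedEmbedding (fun t : Set.Icc (0:ℝ) N => G t) := by
    apply Continuous.isClosedEmbedding (hGc.comp continuous_subtype_val)
    intro x y hxy
    exact Subtype.ext (hmono.injOn x.2.1 y.2.1 hxy)
  refine ⟨fun r => T r, ?_, fun r => (T r).2, hT⟩
  apply continuous_subtype_val.comp
  rw [hemb.isInducing.continuous_iff]
  exact hF.congr (fun r => (hT r).symm)

set_option maxHeartbeats 1000000 in
lemma tal_core (D p q p' m κ : ℝ) (hD : 1 < D) (hp : 1 < p) (hpp : p' = p / (p-1))
    (hκ : 0 < κ) (hq : 0 < q) (hm1 : 1 < m) (hmq : m + q / D = q)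
    (hmp : (m-1) * p' = q) (hmk : m * κ = (D-1) * p') (hk : (D-1)*p' - D = κ)
    (w : ℝ → ℝ) (K : NNReal) (hlip : LipschitzWith K w) (hw0 : ∀ r, 0 ≤ w r)
    (R N : ℝ) (hR : 0 < R) (hwR : w R = 0) (hw00 : 0 < w 0) (hN : 0 < N)
    (hA : ∫ r in (0:ℝ)..R, r^(D-1)*w r^q = ∫ s in (0:ℝ)..N, s^(D-1)*(1+s^p')^(-D)) :
    D*(1+1/κ)*(∫ s in (0:ℝ)..N, s^(D-1)*(1+s^p')^(-D)) - 1/κ * (N^D*(1+N^p')^(1-D))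
      ≤ m/p*κ^(1-p) * ∫ r in (0:ℝ)..R, r^(D-1)*|deriv w r|^p := by
  have hp' : 1 < p' := by rw [hpp, lt_div_iff₀] <;> linarith
  have hwc := hlip.continuous
  -- data
  set g := talg D p' with hgdef
  have hg : Continuous g := talg_cont D p' hD (by linarith)
  set f : ℝ → ℝ := fun r => (max r 0)^(D-1) * w r ^ q with hfdef
  have hf : Continuous f :=
    ((continuous_id.max continuous_const).rpow_const (fun _ => Or.inr (by linarith))).mul
      (hwc.rpow_const (fun _ => Or.inr hq.le))
  have hf0 : ∀ r, 0 ≤ f r := fun r => by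
    have := hw0 r
    simp only [hfdef]; positivity
  set F : ℝ → ℝ := fun t => ∫ s in (0:ℝ)..t, f s with hFdef
  have hFd : ∀ t, HasDerivAt F (f t) t := fun t =>
    intervalIntegral.integral_hasDerivAt_right (hf.intervalIntegrable _ _)
      hf.stronglyMeasurable.stronglyMeasurableAtFilter hf.continuousAt
  have hFc : Continuous F := continuous_iff_continuousAt.2 fun t => (hFd t).continuousAt
  have hFmono : Monotone F := monotone_of_deriv_nonneg (fun t => (hFd t).differentiableAt)
    (fun t => by rw [(hFd t).deriv]; exact hf0 t)
  have hF0 : F 0 = 0 := by simp [hFdef]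
  have hGN : ∫ s in (0:ℝ)..N, g s = ∫ s in (0:ℝ)..N, s^(D-1)*(1+s^p')^(-D) := by
    apply intervalIntegral.integral_congr
    intro s hs
    rw [Set.uIcc_of_le hN.le] at hs
    exact talg_eq D p' s hs.1
  have hFR : F R = ∫ s in (0:ℝ)..N, g s := by
    rw [hGN, ← hA]
    apply intervalIntegral.integral_congr
    intro s hs
    rw [Set.uIcc_of_le hR.le] at hs
    simp [hfdef, max_eq_left hs.1]
  set IN := ∫ s in (0:ℝ)..N, s^(D-1)*(1+s^p')^(-D) with hIN
  have hproj : ∀ r, max 0 (min r R) ∈ Set.Icc 0 R := fun r =>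
    ⟨le_max_left _ _, max_le hR.le (min_le_right _ _)⟩
  obtain ⟨T, hTc, hTm, hGT⟩ := tal_transport g (fun r => F (max 0 (min r R))) hg
    (fun s hs => talg_pos D p' s hs) N IN hN.le hGN
    (hFc.comp (continuous_const.max (continuous_id.min continuous_const)))
    (fun r => by have := hFmono (hproj r).1; rwa [hF0] at this)
    (fun r => by rw [← hGN, ← hFR]; exact hFmono (hproj r).2)
  set G : ℝ → ℝ := fun t => ∫ s in (0:ℝ)..t, g s with hG
  have hGd : ∀ t, HasStrictDerivAt G (g t) t := fun t =>
    intervalIntegral.integral_hasStrictDerivAt_right (hg.intervalIntegrable _ _)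
      hg.stronglyMeasurable.stronglyMeasurableAtFilter hg.continuousAt
  have hGc : Continuous G := continuous_iff_continuousAt.2 fun t => (hGd t).hasDerivAt.continuousAt
  have hGmono : StrictMonoOn G (Set.Ici 0) := by
    apply strictMonoOn_of_deriv_pos (convex_Ici 0) hGc.continuousOn
    intro x hx
    rw [interior_Ici] at hx
    rw [(hGd x).hasDerivAt.deriv]; exact talg_pos _ _ _ hx
  have hGT' : ∀ r ∈ Set.Icc 0 R, G (T r) = F r := by
    intro r hr
    have := hGT r
    simp only [min_eq_left hr.2, max_eq_right hr.1] at this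
    exact this
  have hT0 : T 0 = 0 := by
    apply hGmono.injOn (hTm 0).1 (Set.mem_Ici.2 le_rfl)
    rw [hGT' 0 ⟨le_rfl, hR.le⟩, hF0]; simp [hG]
  have hTR : T R = N := by
    apply hGmono.injOn (hTm R).1 (Set.mem_Ici.2 hN.le)
    rw [hGT' R ⟨hR.le, le_rfl⟩, hFR]
  have hFpos : ∀ r, 0 < r → 0 < F r := by
    intro r hr
    have hev : ∀ᶠ c in nhdsWithin (0:ℝ) (Set.Ioi 0), 0 < w c ∧ c ∈ Set.Ioo 0 r := by
      refine Filter.Eventually.and ?_ (Ioo_mem_nhdsGT hr)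
      exact nhdsWithin_le_nhds (hwc.continuousAt.eventually (lt_mem_nhds hw00))
    obtain ⟨c, hc, hc2⟩ := hev.exists
    apply intervalIntegral.integral_pos hr hf.continuousOn (fun x _ => hf0 x)
    refine ⟨c, ⟨hc2.1.le, hc2.2.le⟩, ?_⟩
    simp only [hfdef, max_eq_left hc2.1.le]
    have := hc2.1
    positivity
  have hTpos : ∀ r ∈ Set.Ioo 0 R, 0 < T r := by
    intro r hr
    rcases (hTm r).1.lt_or_eq with h | h
    · exact h
    · exfalso
      have := hGT' r ⟨hr.1.le, hr.2.le⟩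
      rw [← h] at this
      have h2 := hFpos r hr.1
      simp [hG] at this
      linarith
  have hTd : ∀ r ∈ Set.Ioo 0 R, HasDerivAt T (f r / g (T r)) r := by
    intro r hr
    apply tal_inv (hGd (T r)) (talg_pos _ _ _ (hTpos r hr)).ne' hTc.continuousAt (hFd r)
    filter_upwards [Ioo_mem_nhds hr.1 hr.2] with y hy
    exact hGT' y ⟨hy.1.le, hy.2.le⟩
  -- the function P
  set E : ℝ → ℝ := fun t => t^D*(1+t^p')^(1-D) with hE
  set P : ℝ → ℝ := fun r => (D*(1+1/κ)*F r - 1/κ * E (T r)) - w r ^ m * (r^(D-1) * T r) with hP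
  have hEd : ∀ t, 0 < t → HasDerivAt E
      (D * t^(D-1) * (1+t^p')^(1-D) + t^D * (p' * t^(p'-1) * (1-D) * (1+t^p')^(-D))) t := by
    intro t ht
    have h1 := Real.hasDerivAt_rpow_const (x := t) (p := D) (Or.inl ht.ne')
    have h2 := (Real.hasDerivAt_rpow_const (x := t) (p := p') (Or.inl ht.ne')).const_add 1
    have h3 := h2.rpow_const (p := 1 - D) (Or.inl (by positivity))
    rw [show 1 - D - 1 = -D by ring] at h3
    exact h1.mul h3
  have hEc : ContinuousOn E (Set.Ici 0) := by
    refine ContinuousOn.mul (continuousOn_id.rpow_const (fun _ _ => Or.inr (by linarith))) ?_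
    refine ContinuousOn.rpow_const ?_ ?_
    · exact continuousOn_const.add (continuousOn_id.rpow_const (fun _ _ => Or.inr (by linarith)))
    · intro x hx
      have : 0 ≤ x^p' := Real.rpow_nonneg hx _
      left; positivity
  have hET : Continuous (fun r => E (T r)) :=
    hEc.comp_continuous hTc (fun r => (hTm r).1)
  have hPc : Continuous P := by
    refine ((continuous_const.mul hFc).sub (continuous_const.mul hET)).sub ?_
    exact (hwc.rpow_const (fun _ => Or.inr (by linarith))).mul
      ((continuous_id.rpow_const (fun _ => Or.inr (by linarith))).mul hTc)
  have hint : IntervalIntegrable (fun r => r^(D-1)*|deriv w r|^p) volume 0 R := by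
    apply IntervalIntegrable.continuousOn_mul
    · have hb : IntervalIntegrable (fun _ : ℝ => (K:ℝ)^p) volume 0 R := intervalIntegrable_const
      apply hb.mono_fun
      · exact ((measurable_deriv w).abs.pow_const p).aestronglyMeasurable
      · filter_upwards with x
        have h1 : |deriv w x| ≤ K := by
          simpa using norm_deriv_le_of_lipschitz (x₀ := x) hlip
        rw [Real.norm_of_nonneg (by positivity), Real.norm_of_nonneg (by positivity)]
        gcongr
    · exact continuousOn_id.rpow_const (fun _ _ => Or.inr (by linarith))
  have key : ∀ r₁ r₂, 0 < r₁ → r₁ ≤ r₂ → r₂ < R → P r₂ - P r₁ ≤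
      m/p*κ^(1-p) * ∫ r in (0:ℝ)..R, r^(D-1)*|deriv w r|^p := by
    intro r₁ r₂ h1 h12 h2
    have hsub : Set.Icc r₁ r₂ ⊆ Set.Ioo 0 R := fun x hx => ⟨h1.trans_le hx.1, hx.2.trans_lt h2⟩
    have hSd : ∀ r ∈ Set.Icc r₁ r₂, HasDerivAt (fun r => D*(1+1/κ)*F r - 1/κ * E (T r))
        (D*(1+1/κ)*f r - 1/κ * ((D * T r^(D-1) * (1+T r^p')^(1-D) +
          T r^D * (p' * T r^(p'-1) * (1-D) * (1+T r^p')^(-D))) * (f r / g (T r)))) r := by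
      intro r hr
      exact ((hFd r).const_mul _).sub (((hEd (T r) (hTpos r (hsub hr))).comp r
        (hTd r (hsub hr))).const_mul _)
    have hQd : ∀ r ∈ Set.Icc r₁ r₂, HasDerivAt (fun r => r^(D-1) * T r)
        (((D-1) * r^(D-1-1)) * T r + r^(D-1) * (f r / g (T r))) r := by
      intro r hr
      exact (Real.hasDerivAt_rpow_const (Or.inl (hsub hr).1.ne')).mul (hTd r (hsub hr))
    have hTne : ∀ r ∈ Set.Icc r₁ r₂, T r ≠ 0 := fun r hr => (hTpos r (hsub hr)).ne'
    have hTne1 : ∀ r ∈ Set.Icc r₁ r₂, 1 + T r ^ p' ≠ 0 := fun r hr => by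
      have := hTpos r (hsub hr); positivity
    have hrne : ∀ r ∈ Set.Icc r₁ r₂, r ≠ 0 := fun r hr => (hsub hr).1.ne'
    have hT'c : ContinuousOn (fun r => f r / g (T r)) (Set.Icc r₁ r₂) :=
      hf.continuousOn.div (hg.comp hTc).continuousOn
        (fun r hr => (talg_pos _ _ _ (hTpos r (hsub hr))).ne')
    have cT : ∀ e : ℝ, ContinuousOn (fun r => T r ^ e) (Set.Icc r₁ r₂) := fun e =>
      hTc.continuousOn.rpow_const (fun r hr => Or.inl (hTne r hr))
    have cT1 : ∀ e : ℝ, ContinuousOn (fun r => (1 + T r ^ p') ^ e) (Set.Icc r₁ r₂) := fun e =>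
      (continuousOn_const.add (cT p')).rpow_const (fun r hr => Or.inl (hTne1 r hr))
    have cr : ∀ e : ℝ, ContinuousOn (fun r : ℝ => r ^ e) (Set.Icc r₁ r₂) := fun e =>
      continuousOn_id.rpow_const (fun r hr => Or.inl (hrne r hr))
    have hSac := tal_ac h12 hSd (by
      refine (continuousOn_const.mul hf.continuousOn).sub (continuousOn_const.mul
        (ContinuousOn.mul (ContinuousOn.add ?_ ?_) hT'c))
      · exact (continuousOn_const.mul (cT _)).mul (cT1 _)
      · exact (cT _).mul (((continuousOn_const.mul (cT _)).mul continuousOn_const).mul (cT1 _)))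
    have hQac := tal_ac h12 hQd (by
      exact ((continuousOn_const.mul (cr _)).mul hTc.continuousOn).add ((cr _).mul hT'c))
    have hWac := tal_ac_rpow hlip m hm1.le r₁ r₂
    have hPac : AbsolutelyContinuousOnInterval P r₁ r₂ := hSac.sub (hWac.mul hQac)
    rw [← hPac.integral_deriv_eq_sub]
    have hle : (∫ r in r₁..r₂, deriv P r) ≤
        ∫ r in r₁..r₂, m/p*κ^(1-p) * (r^(D-1)*|deriv w r|^p) := by
      have hi2 : IntervalIntegrable (fun r => r^(D-1)*|deriv w r|^p) volume r₁ r₂ := by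
        apply hint.mono_set
        rw [Set.uIcc_of_le h12, Set.uIcc_of_le hR.le]
        exact hsub.trans Set.Ioo_subset_Icc_self
      apply intervalIntegral.integral_mono_ae_restrict h12 hPac.intervalIntegrable_deriv
        (hi2.const_mul _)
      rw [Filter.EventuallyLE, ae_restrict_iff' measurableSet_Icc]
      filter_upwards [hlip.ae_differentiableAt_real] with r hdw hr
      have hr0 := (hsub hr).1
      have ht := hTpos r (hsub hr)
      have hwr := hw0 r
      have hWd := hdw.hasDerivAt.rpow_const (p := m) (Or.inr hm1.le)
      have hPd := (hSd r hr).sub (hWd.mul (hQd r hr))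
      have hPd' : HasDerivAt P _ r := hPd
      rw [hPd'.deriv]
      set a := f r / g (T r) with ha
      have hgT := talg_eq D p' (T r) ht.le
      have hgp : 0 < g (T r) := talg_pos D p' (T r) ht
      have haf : a * g (T r) = f r := by rw [ha]; field_simp
      have ha0 : 0 ≤ a := div_nonneg (hf0 r) hgp.le
      have hfr : f r = r^(D-1) * w r ^ q := by simp only [hfdef, max_eq_left hr0.le]
      rw [← hgdef] at hgT
      have i1 := tal_pw D q p' m hD hq (by linarith) hmq r (T r) (w r) a hr0 ht hwr ha0
        (by rw [← hgT, haf, hfr])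
      have i2 := tal_young D p q p' m κ hp hpp hκ hm1 hmp hmk r (T r) (w r) |deriv w r|
        hr0 ht hwr (abs_nonneg _)
      rw [← hfr] at i2
      have i3 : -(m * w r ^(m-1) * |deriv w r| * r^(D-1) * T r) ≤
          deriv w r * m * w r ^(m-1) * (r^(D-1) * T r) := by
        have h0 : 0 ≤ m * w r ^(m-1) * r^(D-1) * T r := by positivity
        have := mul_le_mul_of_nonneg_left (neg_abs_le (deriv w r)) h0
        linarith
      have e1 : (1+T r^p')^(1-D) = (1+T r^p') * (1+T r^p')^(-D) := by
        rw [sub_eq_add_neg, Real.rpow_add (by positivity), Real.rpow_one]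
      have e2 : T r ^ D * T r ^(p'-1) = T r^(D-1) * T r ^ p' := by
        rw [← Real.rpow_add ht, ← Real.rpow_add ht]; congr 1; ring
      rw [show D - 1 - 1 = D - 2 by ring]
      set y := T r ^ p' with hy
      set φ := (1 + y)^(-D) with hφ
      have e3 : (D * T r ^ (D - 1) * (1 + y) ^ (1 - D) +
            T r ^ D * (p' * T r ^ (p' - 1) * (1 - D) * φ)) * a
            = f r * (D * (1 + y) - (D-1) * p' * y) := by
        rw [← haf, hgT, e1]
        linear_combination (p' * (1-D) * φ * a) * e2
      have e4 : D*(a*(T r^(D-1)*(1+y)^(1-D))) = D * f r * (1+y) := by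
        rw [← haf, hgT, e1]; ring
      rw [e4] at i1
      rw [e3]
      have e5 : D*(1+1/κ)*f r - 1/κ * (f r * (D * (1 + y) - (D-1) * p' * y))
          = D * f r + f r * y := by
        have : (D-1)*p' = κ + D := by linarith
        rw [this]; field_simp; ring
      rw [e5]
      linarith [i1, i2, i3]
    refine hle.trans ?_
    rw [intervalIntegral.integral_const_mul]
    refine mul_le_mul_of_nonneg_left ?_ (by positivity)
    apply intervalIntegral.integral_mono_interval h1.le h12 h2.le _ hint
    rw [Filter.EventuallyLE, ae_restrict_iff' measurableSet_Ioc]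
    filter_upwards with r hr
    have := hr.1
    simp only [Pi.zero_apply]
    positivity
  set B := m/p*κ^(1-p) * ∫ r in (0:ℝ)..R, r^(D-1)*|deriv w r|^p with hB
  have k1 : ∀ r₁ ∈ Set.Ioo 0 R, P R - P r₁ ≤ B := by
    intro r₁ h1
    have ht : Filter.Tendsto (fun r => P r - P r₁) (nhdsWithin R (Set.Iio R)) (nhds (P R - P r₁)) :=
      ((hPc.tendsto R).sub_const _).mono_left nhdsWithin_le_nhds
    refine le_of_tendsto ht ?_
    filter_upwards [Ioo_mem_nhdsLT h1.2] with r hr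
    exact key r₁ r h1.1 hr.1.le hr.2
  have k2 : P R - P 0 ≤ B := by
    have ht : Filter.Tendsto (fun r => P R - P r) (nhdsWithin 0 (Set.Ioi 0)) (nhds (P R - P 0)) :=
      ((hPc.tendsto 0).const_sub _).mono_left nhdsWithin_le_nhds
    refine le_of_tendsto ht ?_
    filter_upwards [Ioo_mem_nhdsGT hR] with r hr
    exact k1 r hr
  have hP0 : P 0 = 0 := by
    simp only [hP, hF0, hT0, hE]
    rw [Real.zero_rpow (by linarith : D ≠ 0)]; ring
  have hPR : P R = D*(1+1/κ)*IN - 1/κ * E N := by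
    simp only [hP, hTR, hFR, hwR, hGN]
    rw [Real.zero_rpow (by linarith : m ≠ 0)]; ring
  rw [hP0, hPR, sub_zero] at k2
  exact k2


lemma tal_beta (α β : ℝ) (hα : 0 < α) (hβ : 0 < β) :
    IntervalIntegrable (fun x : ℝ => x^(α-1) * (1-x)^(β-1)) volume 0 1 ∧
    ∫ x in (0:ℝ)..1, x^(α-1) * (1-x)^(β-1) = realBeta α β := by
  have hc := Complex.betaIntegral_convergent (u := α) (v := β) (by simpa) (by simpa)
  have heq : ∀ x ∈ Set.Icc (0:ℝ) 1, ((x : ℂ) ^ ((α:ℂ) - 1) * (1 - (x : ℂ)) ^ ((β:ℂ) - 1)) =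
      ((x^(α-1) * (1-x)^(β-1) : ℝ) : ℂ) := by
    intro x hx
    push_cast
    rw [Complex.ofReal_cpow hx.1, Complex.ofReal_cpow (by linarith [hx.2])]
    push_cast; rfl
  constructor
  · have h2 : IntervalIntegrable (fun x : ℝ => ((x^(α-1) * (1-x)^(β-1) : ℝ) : ℂ)) volume 0 1 := by
      refine hc.congr ?_
      intro x hx
      rw [Set.uIoc_of_le zero_le_one] at hx
      exact heq x ⟨hx.1.le, hx.2⟩
    rw [intervalIntegrable_iff] at h2 ⊢
    have := h2.re
    simpa [IntegrableOn] using this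
  · have h3 := ProbabilityTheory.beta_eq_betaIntegralReal α β hα hβ
    have h4 : Complex.betaIntegral α β = ((∫ x in (0:ℝ)..1, x^(α-1) * (1-x)^(β-1) : ℝ) : ℂ) := by
      rw [Complex.betaIntegral, ← intervalIntegral.integral_ofReal]
      apply intervalIntegral.integral_congr
      intro x hx
      rw [Set.uIcc_of_le zero_le_one] at hx
      exact heq x hx
    rw [h4, Complex.ofReal_re] at h3
    rw [← h3]; rfl

lemma tal_I (D p p' : ℝ) (hD : 1 < D) (hp : 1 < p) (hpp : p' = p / (p-1)) :
    Filter.Tendsto (fun N : ℝ => ∫ s in (0:ℝ)..N, s^(D-1)*(1+s^p')^(-D)) Filter.atTop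
      (nhds ((1 / p') * realBeta (D / p) (D / p'))) := by
  have hp' : 1 < p' := by rw [hpp, lt_div_iff₀] <;> linarith
  have hpi : D/p' + D/p = D := by
    rw [hpp]; have : p - 1 ≠ 0 := by linarith
    field_simp; ring
  have hsymm : realBeta (D / p) (D / p') = realBeta (D/p') (D/p) := by
    unfold realBeta; rw [mul_comm, add_comm]
  rw [hsymm]
  have ha : 0 < D/p' := by positivity
  have hb : 0 < D/p := by positivity
  obtain ⟨hi, hB⟩ := tal_beta (D/p') (D/p) ha hb
  set b : ℝ → ℝ := fun x => x^(D/p'-1) * (1-x)^(D/p-1) with hbdef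
  set x : ℝ → ℝ := fun s => 1 - (1 + s^p')⁻¹ with hx
  set B : ℝ → ℝ := fun t => ∫ y in (0:ℝ)..t, b y with hBdef
  have hBc : ContinuousOn B (Set.Icc 0 1) := by
    have := intervalIntegral.continuousOn_primitive_interval' hi (a := 0) (by simp)
    rwa [Set.uIcc_of_le zero_le_one] at this
  have hxm : ∀ s, 0 ≤ s → x s ∈ Set.Icc 0 1 := by
    intro s hs
    have h1 : 0 ≤ s^p' := by positivity
    have h2 : (1 + s^p')⁻¹ ≤ 1 := inv_le_one_of_one_le₀ (by linarith)
    have h3 : 0 ≤ (1 + s^p')⁻¹ := by positivity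
    exact ⟨by simp only [hx]; linarith, by simp only [hx]; linarith⟩
  have hxc : ContinuousOn x (Set.Ici 0) := by
    refine continuousOn_const.sub (ContinuousOn.inv₀ ?_ ?_)
    · exact continuousOn_const.add (continuousOn_id.rpow_const (fun _ _ => Or.inr (by linarith)))
    · intro s hs
      have : 0 ≤ s^p' := Real.rpow_nonneg hs _
      positivity
  have hval : ∀ N, 0 ≤ N → ∫ s in (0:ℝ)..N, s^(D-1)*(1+s^p')^(-D) = (1/p') * B (x N) := by
    intro N hN
    have h0 : x 0 = 0 := by
      simp only [hx]; rw [Real.zero_rpow (by linarith)]; simp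
    have hB0 : B 0 = 0 := by simp [hBdef]
    rw [intervalIntegral.integral_eq_sub_of_hasDerivAt_of_le (f := fun s => (1/p') * B (x s)) hN]
    · simp [h0, hB0]
    · apply continuousOn_const.mul
      apply hBc.comp (hxc.mono (fun s hs => hs.1)) (fun s hs => hxm s hs.1)
    · intro s hs
      have hs0 := hs.1
      have hy : 0 < s^p' := by positivity
      have hx1 : x s = s^p' / (1+s^p') := by simp only [hx]; field_simp; ring
      have hx2 : 1 - x s = (1+s^p')⁻¹ := by simp [hx]
      have hxp : 0 < x s := by rw [hx1]; positivity
      have hxl : 0 < 1 - x s := by rw [hx2]; positivity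
      have hbc : ContinuousAt b (x s) := by
        apply ContinuousAt.mul
        · exact continuousAt_id.rpow_const (Or.inl hxp.ne')
        · exact (continuousAt_const.sub continuousAt_id).rpow_const (Or.inl hxl.ne')
      have hmeas : StronglyMeasurable b := by
        apply Measurable.stronglyMeasurable
        simp only [hbdef]; fun_prop
      have hBd : HasDerivAt B (b (x s)) (x s) := by
        apply intervalIntegral.integral_hasDerivAt_right _ hmeas.stronglyMeasurableAtFilter hbc
        apply hi.mono_set
        rw [Set.uIcc_of_le hxp.le, Set.uIcc_of_le zero_le_one]
        exact Set.Icc_subset_Icc le_rfl (by linarith)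
      have h2 := (Real.hasDerivAt_rpow_const (x := s) (p := p') (Or.inl hs0.ne')).const_add 1
      have h3 := (h2.inv (by positivity)).const_sub 1
      have h4 := (hBd.comp s h3).const_mul (1/p')
      have e : 1 / p' * (b (x s) * -(-(p' * s ^ (p' - 1)) / (1 + s ^ p') ^ 2))
          = s^(D-1)*(1+s^p')^(-D) := by
        simp only [hbdef]
        rw [hx2, hx1]
        set Y := 1 + s^p' with hY
        have hYp : 0 < Y := by positivity
        rw [Real.div_rpow hy.le hYp.le, Real.inv_rpow hYp.le, ← Real.rpow_mul hs0.le]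
        have e1 : s^(p' * (D/p'-1)) * s^(p'-1) = s^(D-1) := by
          rw [← Real.rpow_add hs0]; congr 1; field_simp; ring
        have e2 : Y^(D/p'-1) * Y^(D/p-1) * Y^2 = Y^D := by
          rw [← Real.rpow_natCast, ← Real.rpow_add hYp, ← Real.rpow_add hYp]; congr 1
          push_cast; linarith
        rw [Real.rpow_neg hYp.le, ← e1, ← e2]
        field_simp
      rw [← e]; exact h4
    · apply ((talg_cont D p' hD (by linarith)).intervalIntegrable 0 N).congr
      intro s hs
      rw [Set.uIoc_of_le hN] at hs
      exact talg_eq D p' s hs.1.le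
  have hx1 : Filter.Tendsto x Filter.atTop (nhdsWithin 1 (Set.Icc 0 1)) := by
    apply tendsto_nhdsWithin_of_tendsto_nhds_of_eventually_within
    · have : Filter.Tendsto (fun s : ℝ => (1 + s^p')⁻¹) Filter.atTop (nhds 0) :=
        (Filter.tendsto_atTop_add_const_left _ 1 (tendsto_rpow_atTop (by linarith))).inv_tendsto_atTop
      simpa using this.const_sub 1
    · filter_upwards [Filter.eventually_ge_atTop 0] with s hs using hxm s hs
  have h5 := ((hBc 1 (by simp)).tendsto.comp hx1).const_mul (1/p')
  rw [show B 1 = realBeta (D/p') (D/p) from hB] at h5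
  refine h5.congr' ?_
  filter_upwards [Filter.eventually_ge_atTop 0] with N hN using (hval N hN).symm

lemma tal_eps (D p' κ : ℝ) (hD : 1 < D) (hκ : 0 < κ) (hk : (D-1)*p' - D = κ) :
    Filter.Tendsto (fun N : ℝ => N^D*(1+N^p')^(1-D)) Filter.atTop (nhds 0) := by
  refine squeeze_zero' ?_ ?_ (tendsto_rpow_neg_atTop hκ)
  · filter_upwards [Filter.eventually_gt_atTop 0] with N hN
    positivity
  · filter_upwards [Filter.eventually_gt_atTop 0] with N hN
    have hNp : 0 < N^p' := by positivity
    calc N^D*(1+N^p')^(1-D) ≤ N^D * (N^p')^(1-D) := by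
          refine mul_le_mul_of_nonneg_left ?_ (by positivity)
          exact Real.rpow_le_rpow_of_nonpos hNp (by linarith) (by linarith)
      _ = N^(-κ) := by
          rw [← Real.rpow_mul hN.le, ← Real.rpow_add hN]; congr 1; linarith

lemma tal_core2 (D p q p' m κ : ℝ) (hD : 1 < D) (hp : 1 < p) (hpp : p' = p / (p-1))
    (hκ : 0 < κ) (hq : 0 < q) (hm1 : 1 < m) (hmq : m + q / D = q)
    (hmp : (m-1) * p' = q) (hmk : m * κ = (D-1) * p') (hk : (D-1)*p' - D = κ)
    (hmp2 : 1 + 1/κ = m/p) (hqp : p / q - 1 = - (p / D))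
    (w : ℝ → ℝ) (K : NNReal) (hlip : LipschitzWith K w) (hw0 : ∀ r, 0 ≤ w r)
    (R : ℝ) (hR : 0 < R) (hwR : w R = 0) (hw00 : 0 < w 0)
    (hApos : 0 < ∫ r in (0:ℝ)..R, r^(D-1)*w r^q) :
    (∫ r in (0:ℝ)..R, r^(D-1)*w r^q)^(1/q) ≤
      D ^ (-(1 / p)) * (1/κ) ^ (1 / p') *
          ((1 / p') * realBeta (D / p) (D / p')) ^ (-(1 / D)) *
        (∫ r in (0:ℝ)..R, r^(D-1)*|deriv w r|^p) ^ (1 / p) := by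
  have hp' : 1 < p' := by rw [hpp, lt_div_iff₀] <;> linarith
  set A := ∫ r in (0:ℝ)..R, r^(D-1)*w r^q with hA
  set E := ∫ r in (0:ℝ)..R, r^(D-1)*|deriv w r|^p with hE
  have hE0 : 0 ≤ E := by
    apply intervalIntegral.integral_nonneg hR.le
    intro r hr
    have := hr.1
    positivity
  have hI0 := tal_I D p p' hD hp hpp
  set I := (1 / p') * realBeta (D / p) (D / p') with hI
  have hIpos : 0 < I := by
    have h1 : 0 < D/p := by positivity
    have h2 : 0 < D/p' := by positivity
    have := ProbabilityTheory.beta_pos h1 h2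
    change 0 < realBeta _ _ at this
    positivity
  set IN : ℝ → ℝ := fun N : ℝ => ∫ s in (0:ℝ)..N, s^(D-1)*(1+s^p')^(-D) with hIN
  have hfin : ∀ᶠ N in Filter.atTop, D*(1+1/κ)*IN N - 1/κ * (N^D*(1+N^p')^(1-D))
      ≤ m/p*κ^(1-p) * ((IN N / A)^(p/q) * E) := by
    filter_upwards [Filter.eventually_gt_atTop 0, hI0.eventually (lt_mem_nhds hIpos)] with N hN hNp
    change 0 < IN N at hNp
    set μ := (IN N / A)^(1/q) with hμ
    have hμp : 0 < μ := by positivity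
    have hμq : μ^q * A = IN N := by
      rw [hμ, ← Real.rpow_mul (by positivity), one_div_mul_cancel hq.ne', Real.rpow_one]
      field_simp
    have hμp2 : μ^p = (IN N / A)^(p/q) := by
      rw [hμ, ← Real.rpow_mul (by positivity)]; congr 1; ring
    have hlip2 : LipschitzWith (Real.toNNReal μ * K) (fun r => μ * w r) := by
      apply LipschitzWith.of_dist_le_mul
      intro x y
      have := hlip.dist_le_mul x y
      rw [Real.dist_eq] at this ⊢
      rw [← mul_sub, abs_mul, abs_of_pos hμp]
      push_cast
      rw [Real.coe_toNNReal _ hμp.le, mul_assoc]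
      gcongr
    have := tal_core D p q p' m κ hD hp hpp hκ hq hm1 hmq hmp hmk hk (fun r => μ * w r) _ hlip2
      (fun r => mul_nonneg hμp.le (hw0 r)) R N hR (by simp [hwR]) (by positivity) hN (by
        change _ = IN N
        rw [← hμq, hA, ← intervalIntegral.integral_const_mul]
        congr 1; ext r
        rw [Real.mul_rpow hμp.le (hw0 r)]; ring)
    refine this.trans (le_of_eq ?_)
    rw [← hμp2, hE]
    congr 1
    rw [← intervalIntegral.integral_const_mul]
    apply intervalIntegral.integral_congr
    intro r _
    beta_reduce
    rw [deriv_const_mul_field, abs_mul, abs_of_pos hμp, Real.mul_rpow hμp.le (abs_nonneg _)]; ring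
  have hlim := le_of_tendsto_of_tendsto ((hI0.const_mul (D*(1+1/κ))).sub
      ((tal_eps D p' κ hD hκ hk).const_mul (1/κ)))
    ((((hI0.div_const A).rpow_const (Or.inl (by positivity))).mul_const E).const_mul (m/p*κ^(1-p)))
    hfin
  rw [hmp2, mul_zero, sub_zero] at hlim
  have hmp0 : 0 < m / p := by positivity
  have h1 : D * I ≤ κ^(1-p) * ((I/A)^(p/q) * E) := by
    refine le_of_mul_le_mul_left ?_ hmp0
    linarith
  rw [Real.div_rpow hIpos.le hApos.le] at h1
  have hIe : I^(p/q) = I * I^(-(p/D)) := by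
    rw [← hqp, Real.rpow_sub_one hIpos.ne']; field_simp
  have h2 : A^(p/q) ≤ D⁻¹ * κ^(1-p) * I^(-(p/D)) * E := by
    rw [hIe] at h1
    have hApq : 0 < A^(p/q) := by positivity
    have h3 : D * I * A^(p/q) ≤ (κ^(1-p) * (I * I^(-(p/D)) / A^(p/q) * E)) * A^(p/q) := by gcongr
    have h4 : (κ^(1-p) * (I * I^(-(p/D)) / A^(p/q) * E)) * A^(p/q)
        = D * I * (D⁻¹ * κ^(1-p) * I^(-(p/D)) * E) := by field_simp
    rw [h4] at h3
    exact le_of_mul_le_mul_left h3 (by positivity)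
  have h5 := Real.rpow_le_rpow (by positivity) h2 (show 0 ≤ 1/p by positivity)
  rw [← Real.rpow_mul hApos.le, Real.mul_rpow (by positivity) hE0,
    Real.mul_rpow (by positivity) (by positivity), Real.mul_rpow (by positivity) (by positivity),
    ← Real.rpow_mul hκ.le, ← Real.rpow_mul hIpos.le, Real.inv_rpow (by positivity),
    ← Real.rpow_neg (by positivity)] at h5
  have e1 : p / q * (1/p) = 1/q := by field_simp
  have e2 : κ^((1-p)*(1/p)) = (1/κ)^(1/p') := by
    rw [one_div κ, Real.inv_rpow hκ.le, ← Real.rpow_neg hκ.le, hpp]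
    congr 1
    have : p - 1 ≠ 0 := by linarith
    field_simp; ring
  have e3 : -(p/D) * (1/p) = -(1/D) := by field_simp
  rwa [e1, e2, e3] at h5


/-- Talenti's sharp one-dimensional weighted Sobolev inequality with (possibly
non-integer) dimension `D`. -/
theorem talenti_one_dimensional (D p : ℝ) (hD : 1 < D) (hp1 : 1 < p) (hpD : p < D)
    (q : ℝ) (hq : q = D * p / (D - p)) (p' : ℝ) (hp' : p' = p / (p - 1))
    (u : ℝ → ℝ) (K : NNReal) (hlip : LipschitzWith K u)
    (hInt : IntegrableOn (fun r => r ^ (D - 1) * |deriv u r| ^ p) (Set.Ioi 0))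
    (hlim : Filter.Tendsto u Filter.atTop (nhds 0)) :
    (∫ r in Set.Ioi (0 : ℝ), r ^ (D - 1) * |u r| ^ q) ^ (1 / q)
      ≤ D ^ (-(1 / p)) * ((p - 1) / (D - p)) ^ (1 / p') *
          ((1 / p') * realBeta (D / p) (D / p')) ^ (-(1 / D)) *
        (∫ r in Set.Ioi (0 : ℝ), r ^ (D - 1) * |deriv u r| ^ p) ^ (1 / p) := by
  have hDp : 0 < D - p := by linarith
  have hp0 : 0 < p - 1 := by linarith
  have hD1 : 0 < D - 1 := by linarith
  have hq0 : 0 < q := by rw [hq]; positivity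
  have hp'1 : 1 < p' := by rw [hp', lt_div_iff₀] <;> linarith
  set κ := (D - p) / (p - 1) with hκd
  have hκ : 0 < κ := by positivity
  set m := p * (D - 1) / (D - p) with hmd
  have hm1 : 1 < m := by rw [hmd, lt_div_iff₀ hDp]; nlinarith
  have hκi : (p - 1) / (D - p) = 1 / κ := by rw [hκd]; field_simp
  rw [hκi]
  set Cst := D ^ (-(1 / p)) * (1/κ) ^ (1 / p') *
          ((1 / p') * realBeta (D / p) (D / p')) ^ (-(1 / D)) with hC
  have hC0 : 0 ≤ Cst := by
    have h1 : 0 < D/p := by positivity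
    have h2 : 0 < D/p' := by positivity
    have := ProbabilityTheory.beta_pos h1 h2
    change 0 < realBeta _ _ at this
    positivity
  set E := ∫ r in Set.Ioi (0 : ℝ), r ^ (D - 1) * |deriv u r| ^ p with hE
  have hnn : ∀ v : ℝ → ℝ, ∀ e : ℝ, 0 ≤ᵐ[volume.restrict (Set.Ioi 0)]
      (fun r : ℝ => r ^ (D - 1) * |v r| ^ e) := by
    intro v e
    rw [Filter.EventuallyLE, ae_restrict_iff' measurableSet_Ioi]
    filter_upwards with r hr
    have : (0:ℝ) < r := hr
    simp only [Pi.zero_apply]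
    positivity
  have hE0 : 0 ≤ E := integral_nonneg_of_ae (hnn (deriv u) p)
  set f : ℝ → ℝ := fun r => |deriv u r| with hf
  have hfK : ∀ r, f r ≤ K := fun r => by
    simpa using norm_deriv_le_of_lipschitz (x₀ := r) hlip
  have hf0 : ∀ r, 0 ≤ f r := fun r => abs_nonneg _
  have hfi : ∀ a b, IntervalIntegrable f volume a b := by
    intro a b
    have hb : IntervalIntegrable (fun _ : ℝ => (K:ℝ)) volume a b := intervalIntegrable_const
    apply hb.mono_fun (measurable_deriv u).abs.aestronglyMeasurable
    filter_upwards with x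
    rw [Real.norm_of_nonneg (hf0 x), Real.norm_of_nonneg (by positivity)]
    exact hfK x
  have main : ∀ R, 0 < R →
      ∫ r in (0:ℝ)..R, r^(D-1) * (∫ s in (min r R)..R, f s)^q ≤ (Cst * E^(1/p))^q := by
    intro R hR
    set w : ℝ → ℝ := fun r => ∫ s in (min r R)..R, f s with hw
    have hw0 : ∀ r, 0 ≤ w r := fun r =>
      intervalIntegral.integral_nonneg (min_le_right _ _) (fun s _ => hf0 s)
    have hwR : w R = 0 := by simp [hw]
    have hwl : LipschitzWith K w := by
      apply LipschitzWith.of_dist_le_mul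
      intro x y
      rw [Real.dist_eq, Real.dist_eq]
      have h1 : w x - w y = ∫ s in (min x R)..(min y R), f s := by
        have := intervalIntegral.integral_add_adjacent_intervals (hfi (min x R) (min y R))
          (hfi (min y R) R)
        simp only [hw]; linarith
      rw [h1]
      have h2 := intervalIntegral.norm_integral_le_of_norm_le_const (a := min x R) (b := min y R)
        (f := f) (C := K) (fun s _ => by rw [Real.norm_of_nonneg (hf0 s)]; exact hfK s)
      rw [Real.norm_eq_abs] at h2
      refine h2.trans ?_
      refine mul_le_mul_of_nonneg_left ?_ K.2
      rw [abs_sub_comm]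
      have := abs_min_sub_min_le_max x R y R
      simpa using this
    have hanti : ∀ r ∈ Set.Icc 0 R, w r ≤ w 0 := by
      intro r hr
      have := intervalIntegral.integral_add_adjacent_intervals (hfi 0 r) (hfi r R)
      have h3 : 0 ≤ ∫ s in (0:ℝ)..r, f s :=
        intervalIntegral.integral_nonneg hr.1 (fun s _ => hf0 s)
      simp only [hw, min_eq_left hr.2, min_eq_left hR.le]
      linarith
    rcases lt_or_ge 0 (∫ r in (0:ℝ)..R, r^(D-1)*w r^q) with hA | hA
    swap
    · exact hA.trans (by positivity)
    have hw00 : 0 < w 0 := by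
      rcases (hw0 0).lt_or_eq with h | h
      · exact h
      · exfalso
        have : ∫ r in (0:ℝ)..R, r^(D-1)*w r^q = ∫ r in (0:ℝ)..R, 0 := by
          apply intervalIntegral.integral_congr
          intro r hr
          rw [Set.uIcc_of_le hR.le] at hr
          have : w r = 0 := le_antisymm (by rw [h]; exact hanti r hr) (hw0 r)
          simp [this, Real.zero_rpow hq0.ne']
        rw [this] at hA
        simp at hA
    have hc := tal_core2 D p q p' m κ hD hp1 hp' hκ hq0 hm1
      (by rw [hmd, hq]; field_simp; ring)
      (by rw [hmd, hq, hp']; field_simp; ring)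
      (by rw [hmd, hκd, hp']; field_simp)
      (by rw [hκd, hp']; field_simp; ring)
      (by rw [hmd, hκd]; field_simp; ring)
      (by rw [hq]; field_simp; ring)
      w K hwl hw0 R hR hwR hw00 hA
    have hder : ∫ r in (0:ℝ)..R, r^(D-1)*|deriv w r|^p =
        ∫ r in (0:ℝ)..R, r^(D-1)*|deriv u r|^p := by
      apply intervalIntegral.integral_congr_ae
      have hR' : ∀ᵐ x : ℝ, x ≠ R := by
        simp [ae_iff]
      filter_upwards [(hfi 0 R).ae_hasDerivAt_integral, hR'] with r hr hrR hr2
      rw [Set.uIoc_of_le hR.le] at hr2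
      have hrR' : r < R := lt_of_le_of_ne hr2.2 hrR
      have h1 := hr (by rw [Set.uIcc_of_le hR.le]; exact ⟨hr2.1.le, hr2.2⟩) R (by simp)
      have h2 : HasDerivAt w (-f r) r := by
        refine h1.neg.congr_of_eventuallyEq ?_
        filter_upwards [Iio_mem_nhds hrR'] with y hy
        simp only [hw, min_eq_left (le_of_lt (Set.mem_Iio.1 hy)), Pi.neg_apply]
        rw [intervalIntegral.integral_symm]
      rw [h2.deriv, abs_neg, hf]
      simp
    rw [hder] at hc
    have hER : (∫ r in (0:ℝ)..R, r^(D-1)*|deriv u r|^p) ≤ E := by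
      rw [intervalIntegral.integral_of_le hR.le]
      exact setIntegral_mono_set hInt (hnn (deriv u) p) Set.Ioc_subset_Ioi_self.eventuallyLE
    have hER0 : 0 ≤ (∫ r in (0:ℝ)..R, r^(D-1)*|deriv u r|^p) := by
      apply intervalIntegral.integral_nonneg hR.le
      intro r hr
      have := hr.1
      positivity
    have hc2 := hc.trans (mul_le_mul_of_nonneg_left
      (Real.rpow_le_rpow hER0 hER (show 0 ≤ 1/p by positivity)) hC0)
    have hc3 := Real.rpow_le_rpow (by positivity) hc2 hq0.le
    rwa [← Real.rpow_mul hA.le, one_div_mul_cancel hq0.ne', Real.rpow_one] at hc3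
  -- passage to the limit
  suffices hs : (∫ r in Set.Ioi (0 : ℝ), r ^ (D - 1) * |u r| ^ q) ≤ (Cst * E^(1/p))^q by
    have := Real.rpow_le_rpow (integral_nonneg_of_ae (hnn u q)) hs
      (show 0 ≤ 1/q by positivity)
    rwa [← Real.rpow_mul (by positivity), mul_one_div_cancel hq0.ne', Real.rpow_one] at this
  by_cases hi : IntegrableOn (fun r => r ^ (D - 1) * |u r| ^ q) (Set.Ioi 0)
  swap
  · rw [integral_undef hi]; positivity
  have huc := hlip.continuous
  set φ : ℕ → ℝ → ℝ := fun n r => Set.indicator (Set.Ioc 0 (n:ℝ))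
    (fun r => r^(D-1) * (max (|u r| - |u n|) 0)^q) r with hφ
  have hcont : ∀ c : ℝ, Continuous (fun r => r^(D-1) * (max (|u r| - c) 0)^q) := by
    intro c
    refine (continuous_id.rpow_const (fun _ => Or.inr (by linarith))).mul ?_
    exact ((huc.abs.sub continuous_const).max continuous_const).rpow_const
      (fun _ => Or.inr hq0.le)
  have ht : Filter.Tendsto (fun n => ∫ r in Set.Ioi (0:ℝ), φ n r) Filter.atTop
      (nhds (∫ r in Set.Ioi (0 : ℝ), r ^ (D - 1) * |u r| ^ q)) := by
    apply tendsto_integral_of_dominated_convergence (fun r => r ^ (D - 1) * |u r| ^ q)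
    · intro n
      exact ((hcont _).measurable.indicator measurableSet_Ioc).aestronglyMeasurable
    · exact hi
    · intro n
      rw [ae_restrict_iff' measurableSet_Ioi]
      filter_upwards with r hr
      have hr0 : (0:ℝ) < r := hr
      simp only [hφ]
      by_cases hrn : r ∈ Set.Ioc 0 (n:ℝ)
      · rw [Set.indicator_of_mem hrn, Real.norm_of_nonneg (by positivity)]
        gcongr
        apply max_le _ (abs_nonneg _)
        linarith [abs_nonneg (u n)]
      · rw [Set.indicator_of_notMem hrn, norm_zero]; positivity
    · rw [ae_restrict_iff' measurableSet_Ioi]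
      filter_upwards with r hr
      have hr0 : (0:ℝ) < r := hr
      have hun : Filter.Tendsto (fun n : ℕ => |u n|) Filter.atTop (nhds 0) := by
        simpa using (hlim.comp tendsto_natCast_atTop_atTop).abs
      have h1 : Filter.Tendsto (fun n : ℕ => r^(D-1) * (max (|u r| - |u n|) 0)^q) Filter.atTop
          (nhds (r^(D-1) * |u r|^q)) := by
        have h2 := ((hun.const_sub |u r|).max (tendsto_const_nhds (x := (0:ℝ))))
        rw [sub_zero, max_eq_left (abs_nonneg _)] at h2
        exact (h2.rpow_const (Or.inr hq0.le)).const_mul _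
      refine h1.congr' ?_
      filter_upwards [Filter.eventually_ge_atTop ⌈r⌉₊] with n hn
      have : r ∈ Set.Ioc 0 (n:ℝ) := ⟨hr0, Nat.ceil_le.1 hn⟩
      simp only [hφ]
      rw [Set.indicator_of_mem this]
  refine le_of_tendsto ht ?_
  filter_upwards [Filter.eventually_gt_atTop 0] with n hn
  have hnR : (0:ℝ) < n := by exact_mod_cast hn
  refine le_trans ?_ (main n hnR)
  simp only [hφ]
  rw [setIntegral_indicator measurableSet_Ioc, Set.inter_eq_right.2 Set.Ioc_subset_Ioi_self,
    ← intervalIntegral.integral_of_le hnR.le]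
  have hwc : ContinuousOn (fun r => r^(D-1) * (∫ s in (min r (n:ℝ))..n, f s)^q)
      (Set.uIcc 0 (n:ℝ)) := by
    refine (continuousOn_id.rpow_const (fun _ _ => Or.inr (by linarith))).mul ?_
    refine ContinuousOn.rpow_const ?_ (fun _ _ => Or.inr hq0.le)
    have h1 : Continuous (fun x => ∫ s in (0:ℝ)..x, f s) :=
      intervalIntegral.continuous_primitive hfi 0
    have h2 : Continuous (fun r : ℝ => (∫ s in (0:ℝ)..n, f s) - ∫ s in (0:ℝ)..(min r (n:ℝ)), f s) :=
      continuous_const.sub (h1.comp (continuous_id.min continuous_const))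
    refine (h2.congr ?_).continuousOn
    intro r
    rw [intervalIntegral.integral_interval_sub_left (hfi _ _) (hfi _ _)]
  apply intervalIntegral.integral_mono_on hnR.le ((hcont _).intervalIntegrable _ _)
    hwc.intervalIntegrable
  intro r hr
  have hr0 := hr.1
  refine mul_le_mul_of_nonneg_left ?_ (by positivity)
  refine Real.rpow_le_rpow (by positivity) ?_ hq0.le
  rw [min_eq_left hr.2]
  apply max_le
  · have h1 := (hlip.lipschitzOnWith (s := Set.uIcc r n)).absolutelyContinuousOnInterval.integral_deriv_eq_sub
    have h2 := intervalIntegral.abs_integral_le_integral_abs (f := deriv u) (μ := volume) hr.2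
    rw [h1] at h2
    refine le_trans ?_ h2
    rw [abs_sub_comm]
    exact abs_sub_abs_le_abs_sub _ _
  · exact intervalIntegral.integral_nonneg hr.2 (fun s _ => hf0 s)
end
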